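/- arXiv:0804.4842 — 3 statements merged into one kernel-verified Lean document; each statement's English description precedes it below -/
import Mathlib

section
/- Let (Σ) be quasi-regular at a minimal prime differential ideal 𝔓 satisfying the standing rank hypothesis, and let 𝓔₀ = (ε_{ij}) be the r×n nonnegative integer matrix with ε_{ij} = ord_{X_j}(f_i) and ε_{ij} = 0 whenever X_j does not appear in f_i. Then for every k ≥ e − min{ε_{ij}}, the inequalities er − J(𝓔₀) ≤ μ_k ≤ er − ord(𝔓) hold. -/
set_option synthInstance.maxHeartbeats 1000000
set_option maxHeartbeats 4000000

noncomputable section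

namespace DAE

open MvPolynomial

/-- The ring of differential polynomials `K{X_1,…,X_n}`: the polynomial ring in the
variables `X_j^{(l)}`, `1 ≤ j ≤ n`, `l ∈ ℕ`. -/
abbrev DP (K : Type) [Field K] (n : ℕ) : Type := MvPolynomial (Fin n × ℕ) K

variable {K : Type} [Field K] {n : ℕ}

/-- `δ : K → K` is a derivation of the field `K`. -/
structure IsDeriv (K : Type) [Field K] (δ : K → K) : Prop where
  map_add : ∀ a b, δ (a + b) = δ a + δ b
  leibniz : ∀ a b, δ (a * b) = a * δ b + b * δ a

/-- `D` is the total derivation of `K{X}` extending the derivation `δ` of `K`, with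
`D X_j^{(l)} = X_j^{(l+1)}`. The `p`-th total derivative of `g` is `D^[p] g`. -/
structure IsTotalDeriv (K : Type) [Field K] (n : ℕ) (δ : K → K) (D : DP K n → DP K n) : Prop where
  map_add : ∀ f g, D (f + g) = D f + D g
  leibniz : ∀ f g, D (f * g) = f * D g + g * D f
  map_C : ∀ a : K, D (C a) = C (δ a)
  map_X : ∀ (j : Fin n) (l : ℕ), D (X (j, l)) = X (j, l + 1)

/-- the maximal order of derivation of `X_j` appearing in `f` (`0` when absent) -/
def ordIn (f : DP K n) (j : Fin n) : ℕ :=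
  (f.vars.filter fun v => v.1 = j).sup fun v => v.2

/-- some derivative of `X_j` appears in `f` -/
def appearsIn (f : DP K n) (j : Fin n) : Prop :=
  (f.vars.filter fun v => v.1 = j).Nonempty

instance {K : Type} [Field K] {n : ℕ} (f : DP K n) (j : Fin n) : Decidable (appearsIn f j) := by
  unfold appearsIn; infer_instance

/-- the order of `f`: maximal order of derivation of a variable appearing in `f` -/
def ordOf (f : DP K n) : ℕ := f.vars.sup fun v => v.2

/-- `I` is a differential ideal (stable under the total derivation `D`) -/
def IsDiffIdeal (D : DP K n → DP K n) (I : Ideal (DP K n)) : Prop := ∀ g ∈ I, D g ∈ I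

/-- the differential ideal `[f_1,…,f_r]` generated by `f_1,…,f_r` -/
def diffIdealGen (D : DP K n → DP K n) {r : ℕ} (f : Fin r → DP K n) : Ideal (DP K n) :=
  sInf {I | (∀ t, f t ∈ I) ∧ IsDiffIdeal D I}

/-- `𝔓` is a prime differential ideal, minimal among those containing `f_1,…,f_r` -/
def IsMinimalPrimeDiff (D : DP K n → DP K n) {r : ℕ} (f : Fin r → DP K n)
    (𝔓 : Ideal (DP K n)) : Prop :=
  𝔓.IsPrime ∧ IsDiffIdeal D 𝔓 ∧ (∀ t, f t ∈ 𝔓) ∧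
    ∀ Q : Ideal (DP K n), Q.IsPrime → IsDiffIdeal D Q → (∀ t, f t ∈ Q) → Q ≤ 𝔓 → Q = 𝔓

/-- the polynomial ring `A_i := K[X^{[i]}]` -/
abbrev AP (K : Type) [Field K] (n i : ℕ) : Type := MvPolynomial (Fin n × Fin (i + 1)) K

/-- the inclusion `A_i ↪ K{X}` -/
def inclA (K : Type) [Field K] (n i : ℕ) : AP K n i →+* DP K n :=
  (rename fun v : Fin n × Fin (i + 1) => ((v.1, (v.2 : ℕ)) : Fin n × ℕ)).toRingHom

/-- the truncation `K{X} → A_i` (a retraction of `inclA`, exact on polynomials of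
order at most `i`) -/
def truncA (K : Type) [Field K] (n i : ℕ) : DP K n →+* AP K n i :=
  (aeval fun v : Fin n × ℕ =>
    if h : v.2 < i + 1 then (X (v.1, ⟨v.2, h⟩) : AP K n i) else 0).toRingHom

/-- the contraction `A_i ∩ 𝔓` -/
def Pc {K : Type} [Field K] {n : ℕ} (i : ℕ) (𝔓 : Ideal (DP K n)) : Ideal (AP K n i) :=
  𝔓.comap (inclA K n i)

instance {K : Type} [Field K] {n : ℕ} (i : ℕ) (𝔓 : Ideal (DP K n)) [𝔓.IsPrime] :
    (Pc i 𝔓).IsPrime := Ideal.IsPrime.comap _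

/-- the local ring `B_i`: the localization of `A_i` at the prime `A_i ∩ 𝔓` -/
abbrev BL (K : Type) [Field K] (n : ℕ) (i : ℕ) (𝔓 : Ideal (DP K n)) [𝔓.IsPrime] : Type :=
  Localization.AtPrime (Pc (K := K) (n := n) i 𝔓)

/-- the transition map `A_i → A_{i'}` for `i ≤ i'` -/
def renAA (K : Type) [Field K] (n : ℕ) {i i' : ℕ} (h : i ≤ i') : AP K n i →+* AP K n i' :=
  (rename (Prod.map (id : Fin n → Fin n) (Fin.castLE (by omega)))).toRingHom

lemma inclA_comp_renAA (K : Type) [Field K] (n : ℕ) {i i' : ℕ} (h : i ≤ i') :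
    (inclA K n i').comp (renAA K n h) = inclA K n i := by
  ext p
  · simp [inclA, renAA]
  · simp [inclA, renAA]

lemma Pc_eq_comap {K : Type} [Field K] {n : ℕ} (𝔓 : Ideal (DP K n)) {i i' : ℕ} (h : i ≤ i') :
    Pc i 𝔓 = (Pc i' 𝔓).comap (renAA K n h) := by
  unfold Pc
  rw [Ideal.comap_comap, inclA_comp_renAA]

/-- the canonical local map `B_i → B_{i'}`, `i ≤ i'` -/
def ringBB {K : Type} [Field K] {n : ℕ} (𝔓 : Ideal (DP K n)) [𝔓.IsPrime] {i i' : ℕ}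
    (h : i ≤ i') : BL K n i 𝔓 →+* BL K n i' 𝔓 :=
  Localization.localRingHom _ _ (renAA K n h) (Pc_eq_comap 𝔓 h)

/-- the canonical local map `B_i → K{X}_𝔓` -/
def ringBP {K : Type} [Field K] {n : ℕ} (𝔓 : Ideal (DP K n)) [𝔓.IsPrime] (i : ℕ) :
    BL K n i 𝔓 →+* Localization.AtPrime 𝔓 :=
  Localization.localRingHom _ _ (inclA K n i) rfl

/-- the image in `B_j` of a differential polynomial (of order `≤ j`) -/
def bElem {K : Type} [Field K] {n : ℕ} (𝔓 : Ideal (DP K n)) [𝔓.IsPrime] (j : ℕ)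
    (g : DP K n) : BL K n j 𝔓 :=
  algebraMap (AP K n j) (BL K n j 𝔓) (truncA K n j g)

/-- the prolongation ideal `Δ_m = (f_1^{[m-1]},…,f_r^{[m-1]})` in the ring `B_j` -/
def prolong (D : DP K n → DP K n) {r : ℕ} (f : Fin r → DP K n)
    (𝔓 : Ideal (DP K n)) [𝔓.IsPrime] (m j : ℕ) : Ideal (BL K n j 𝔓) :=
  Ideal.span {x | ∃ (t : Fin r) (s : ℕ) (a : AP K n j),
    s < m ∧ inclA K n j a = D^[s] (f t) ∧ x = algebraMap (AP K n j) (BL K n j 𝔓) a}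

/-- `Δ := 𝔓·K{X}_𝔓` -/
def bigDelta {K : Type} [Field K] {n : ℕ} (𝔓 : Ideal (DP K n)) [𝔓.IsPrime] :
    Ideal (Localization.AtPrime 𝔓) :=
  Ideal.map (algebraMap (DP K n) (Localization.AtPrime 𝔓)) 𝔓

instance {K : Type} [Field K] {n : ℕ} (𝔓 : Ideal (DP K n)) [𝔓.IsPrime] :
    IsDomain (DP K n ⧸ 𝔓) := Ideal.Quotient.isDomain 𝔓

/-- `𝕂 := Frac(K{X}/𝔓)`, the residual field of `𝔓` -/
abbrev KK (K : Type) [Field K] (n : ℕ) (𝔓 : Ideal (DP K n)) [𝔓.IsPrime] : Type :=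
  FractionRing (DP K n ⧸ 𝔓)

/-- the canonical map `K{X} → 𝕂` -/
def toKK {K : Type} [Field K] {n : ℕ} (𝔓 : Ideal (DP K n)) [𝔓.IsPrime] :
    DP K n →+* KK K n 𝔓 :=
  (algebraMap (DP K n ⧸ 𝔓) (KK K n 𝔓)).comp (Ideal.Quotient.mk 𝔓)

/-- the Jacobian matrix of `f_1^{[i-1]},…,f_r^{[i-1]}` with respect to `X^{[i-1+e]}`,
with entries taken in `𝕂` (full row rank over the domain `A_{i-1+e}/(A_{i-1+e}∩𝔓)` is
equivalent to full rank over its fraction field, hence over `𝕂`). -/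
def qrJac (D : DP K n → DP K n) {r : ℕ} (f : Fin r → DP K n)
    (𝔓 : Ideal (DP K n)) [𝔓.IsPrime] (e i : ℕ) :
    Matrix (Fin r × Fin i) (Fin n × Fin (i + e)) (KK K n 𝔓) :=
  fun p q => toKK 𝔓 (pderiv (q.1, (q.2 : ℕ)) (D^[(p.2 : ℕ)] (f p.1)))

/-- the system `f_1,…,f_r` is quasi-regular at `𝔓` -/
def IsQuasiRegularAt (D : DP K n → DP K n) {r : ℕ} (f : Fin r → DP K n)
    (𝔓 : Ideal (DP K n)) [𝔓.IsPrime] (e : ℕ) : Prop :=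
  ∀ i : ℕ, 1 ≤ i → (qrJac D f 𝔓 e i).rank = r * i

/-- the entry of the pseudo-Jacobian `𝔍_{k,i}` in block `(p,q)`, row `t := p.2`,
column `j := q.2`: `∂ f_t^{(i-e+1+p)} / ∂ X_j^{(i+1+q)}` -/
def jEntry (D : DP K n → DP K n) {r : ℕ} (f : Fin r → DP K n) (e i : ℕ) {k : ℕ}
    (p : Fin k × Fin r) (q : Fin k × Fin n) : DP K n :=
  pderiv (q.2, i + 1 + (q.1 : ℕ)) (D^[i + 1 - e + (p.1 : ℕ)] (f p.2))

/-- the pseudo-Jacobian `𝔍_{k,i}` over `𝕂` -/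
def Jmat (D : DP K n → DP K n) {r : ℕ} (f : Fin r → DP K n)
    (𝔓 : Ideal (DP K n)) [𝔓.IsPrime] (e k i : ℕ) :
    Matrix (Fin k × Fin r) (Fin k × Fin n) (KK K n 𝔓) :=
  fun p q => toKK 𝔓 (jEntry D f e i p q)

/-- `μ_{k,i} := kr − rank_𝕂 𝔍_{k,i}` -/
def mu (D : DP K n → DP K n) {r : ℕ} (f : Fin r → DP K n)
    (𝔓 : Ideal (DP K n)) [𝔓.IsPrime] (e k i : ℕ) : ℕ :=
  k * r - (Jmat D f 𝔓 e k i).rank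

/-- the pseudo-Jacobian `𝔍_{k,i}` over the ring `B_j / Δ_m` -/
def JmatOver (D : DP K n → DP K n) {r : ℕ} (f : Fin r → DP K n)
    (𝔓 : Ideal (DP K n)) [𝔓.IsPrime] (e k i m j : ℕ) :
    Matrix (Fin k × Fin r) (Fin k × Fin n) (BL K n j 𝔓 ⧸ prolong D f 𝔓 m j) :=
  fun p q => Ideal.Quotient.mk _ (bElem 𝔓 j (jEntry D f e i p q))

/-- the standing rank hypothesis: for every `k,i` the rank of `𝔍_{k,i}` over the
domain `B_{i+k+s}/Δ_{i-1+e+k+s}` does not depend on `s` and equals its rank over `𝕂` -/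
def StandingRank (D : DP K n → DP K n) {r : ℕ} (f : Fin r → DP K n)
    (𝔓 : Ideal (DP K n)) [𝔓.IsPrime] (e : ℕ) : Prop :=
  ∀ k i s : ℕ, 1 ≤ k → e - 1 ≤ i →
    (JmatOver D f 𝔓 e k i (i - 1 + e + k + s) (i + k + s)).rank = (Jmat D f 𝔓 e k i).rank

/-- the Jacobi number of a matrix of natural numbers -/
def jacobiN {ι κ : Type} [Fintype ι] [Fintype κ] [DecidableEq ι] [DecidableEq κ]
    (M : ι → κ → ℕ) : ℕ :=
  Finset.univ.sup fun τ : {τ : ι → κ // Function.Injective τ} => ∑ i, M i (τ.1 i)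

/-- the Jacobi number of a matrix with entries in `ℕ₀ ∪ {−∞}` -/
def jacobiE {ι κ : Type} [Fintype ι] [Fintype κ] [DecidableEq ι] [DecidableEq κ]
    (M : ι → κ → WithBot ℕ) : WithBot ℕ :=
  Finset.univ.sup fun τ : {τ : ι → κ // Function.Injective τ} => ∑ i, M i (τ.1 i)

/-- the (finite) transcendence degree of `E` over `F` equals `d` -/
def HasTrdeg (F E : Type) [CommRing F] [CommRing E] [Algebra F E] (d : ℕ) : Prop :=
  ∃ s : Finset E, IsTranscendenceBasis F (fun x : {x : E // x ∈ s} => x.1) ∧ s.card = d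

end DAE

namespace DAE

open scoped IntermediateField.algebraAdjoinAdjoin in
lemma linInd_D_basis {K L ι : Type} [Field K] [Field L] [CharZero K] [Algebra K L] (v : ι → L)
    (hv : IsTranscendenceBasis K v) :
    LinearIndependent L (fun i => KaehlerDifferential.D K L (v i)) := by
  let P := MvPolynomial ι K
  let S := Algebra.adjoin K (Set.range v)
  let E := IntermediateField.adjoin K (Set.range v)
  have hPS : P ≃ₐ[K] S := hv.1.aevalEquiv
  let a1 : Algebra P S := (hv.1.aevalEquiv : P →+* S).toAlgebra
  let a2 : Algebra P L := (MvPolynomial.aeval v : P →ₐ[K] L).toRingHom.toAlgebra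
  have t1 : IsScalarTower P S L := IsScalarTower.of_algebraMap_eq (fun p => by
    exact (hv.1.algebraMap_aevalEquiv p).symm)
  have t2 : IsScalarTower K P L := IsScalarTower.of_algebraMap_eq (fun p => by
    exact ((MvPolynomial.aeval v : P →ₐ[K] L).commutes p).symm)
  have f1 : Algebra.FormallyEtale P S := 
    Algebra.FormallyEtale.of_equiv (R := P) (A := P) (B := S)
      { hv.1.aevalEquiv with commutes' := fun r => rfl }
  have f2 : Algebra.FormallyEtale S E := .of_isLocalization (nonZeroDivisors _)
  have : Algebra.IsAlgebraic E L := hv.isAlgebraic_field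
  have : CharZero E := charZero_of_injective_algebraMap (algebraMap K E).injective
  have f3 : Algebra.FormallyEtale E L := Algebra.FormallyEtale.of_isSeparable _ L
  have f4 : Algebra.FormallyEtale S L := .comp _ E _
  have f5 : Algebra.FormallyEtale P L := .comp _ S _
  have := ((KaehlerDifferential.isBaseChange_of_formallyEtale K P L).basis (KaehlerDifferential.mvPolynomialBasis K ι)).linearIndependent
  convert! this using 2 with i
  rw [IsBaseChange.basis_apply, KaehlerDifferential.mvPolynomialBasis_apply,
    KaehlerDifferential.map_D]
  have h : algebraMap P L (MvPolynomial.X i) = v i := MvPolynomial.aeval_X (R := K) v i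
  exact congrArg _ h.symm

lemma linInd_D {K L ι : Type} [Field K] [Field L] [CharZero K] [Algebra K L] (v : ι → L)
    (hv : AlgebraicIndependent K v) :
    LinearIndependent L (fun i => KaehlerDifferential.D K L (v i)) := by
  obtain ⟨t, ht, hb⟩ := exists_isTranscendenceBasis_superset hv.coe_range
  have h := linInd_D_basis _ hb
  have := h.comp (fun i : ι => (⟨v i, ht ⟨i, rfl⟩⟩ : t)) (fun i j hij => hv.injective (congrArg Subtype.val hij))
  exact this

lemma rank_cover {F ι κ : Type} [Field F] [Fintype ι] [Fintype κ] [DecidableEq ι] [DecidableEq κ]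
    (A : Matrix ι κ F) (R : Finset ι) (C : Finset κ)
    (h : ∀ i j, i ∉ R → j ∉ C → A i j = 0) : A.rank ≤ R.card + C.card := by
  let A1 : Matrix ι κ F := Matrix.of fun i j => if i ∈ R then A i j else 0
  let A2 : Matrix ι κ F := Matrix.of fun i j => if i ∈ R then 0 else A i j
  have hA : A = A1 + A2 := by
    ext i j; simp only [Matrix.add_apply, Matrix.of_apply, A1, A2]; split_ifs <;> simp
  have h1 : A1.rank ≤ R.card := by
    apply Matrix.rank_le_card_of_support_subset
    rw [Function.support_subset_iff']
    intro i hi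
    ext j
    have hi' : i ∉ R := by simpa using hi
    simp [Matrix.row, A1, hi']
  have h2 : A2.rank ≤ C.card := by
    rw [← Matrix.rank_transpose]
    apply Matrix.rank_le_card_of_support_subset
    rw [Function.support_subset_iff']
    intro j hj
    ext i
    have hj' : j ∉ C := by simpa using hj
    simp only [Matrix.row, Matrix.transpose_apply, Matrix.of_apply, A2, Pi.zero_apply]
    split_ifs with hi
    · rfl
    · exact h i j hi hj'
  have h3 : A.rank ≤ A1.rank + A2.rank := by
    rw [hA]
    unfold Matrix.rank
    rw [Matrix.mulVecLin_add]
    refine le_trans (Submodule.finrank_mono ?_) (Submodule.finrank_add_le_finrank_add_finrank _ _)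
    rintro _ ⟨x, rfl⟩
    exact Submodule.add_mem_sup ⟨x, rfl⟩ ⟨x, rfl⟩
  omega

/-- Egerváry duality, square case, integer potentials -/
lemma egervary_sq {ι : Type} [Fintype ι] [DecidableEq ι] (w : ι → ι → ℤ) :
    ∃ (u v : ι → ℤ) (τ : ι → ι), Function.Injective τ ∧ (∀ i j, w i j ≤ u i + v j) ∧
      ∀ i, w i (τ i) = u i + v (τ i) := by
  classical
  -- minimal gap
  let Q : ℕ → Prop := fun N => ∃ (u v : ι → ℤ), (∀ i j, w i j ≤ u i + v j) ∧
      ∑ i, u i + ∑ i, v i - ∑ i, w i i = N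
  have hQ : ∃ N, Q N := by
    refine ⟨(∑ i, (∑ j, |w i j|) - ∑ i, w i i).toNat, fun i => ∑ j, |w i j|, 0, ?_, ?_⟩
    · intro i j
      simp only [Pi.zero_apply, add_zero]
      exact (le_abs_self _).trans (Finset.single_le_sum (f := fun j => |w i j|) (fun _ _ => abs_nonneg _) (Finset.mem_univ j))
    · rw [Int.toNat_of_nonneg]
      · simp
      · rw [← Finset.sum_sub_distrib]
        apply Finset.sum_nonneg
        intro i _
        have := (le_abs_self _).trans (Finset.single_le_sum (f := fun j => |w i j|) (fun _ _ => abs_nonneg _) (Finset.mem_univ i))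
        linarith
  obtain ⟨u, v, huv, hs⟩ := Nat.find_spec hQ
  let T : ι → Finset ι := fun i => Finset.univ.filter fun j => w i j = u i + v j
  have hall : ∀ s : Finset ι, s.card ≤ (s.biUnion T).card := by
    intro s
    by_contra hlt
    push Not at hlt
    let u' : ι → ℤ := fun i => u i - if i ∈ s then 1 else 0
    let v' : ι → ℤ := fun j => v j + if j ∈ s.biUnion T then 1 else 0
    have hf : ∀ i j, w i j ≤ u' i + v' j := by
      intro i j
      have := huv i j
      simp only [u', v']
      by_cases hi : i ∈ s
      · by_cases hj : j ∈ s.biUnion T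
        · simp only [hi, hj, if_true]; linarith
        · simp only [hi, hj, if_true, if_false]
          have : w i j ≠ u i + v j := by
            intro h
            exact hj (Finset.mem_biUnion.2 ⟨i, hi, by simp [T, h]⟩)
          have := lt_of_le_of_ne (huv i j) this
          linarith
      · simp only [hi, if_false]; split_ifs <;> linarith
    have hsum : ∑ i, u' i + ∑ i, v' i - ∑ i, w i i = (Nat.find hQ : ℤ) - s.card + (s.biUnion T).card := by
      simp only [u', v', Finset.sum_sub_distrib, Finset.sum_add_distrib, Finset.sum_ite_mem,
        Finset.univ_inter, Finset.sum_const, nsmul_eq_mul, mul_one]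
      linarith
    have hnn : 0 ≤ ∑ i, u' i + ∑ i, v' i - ∑ i, w i i := by
      rw [← Finset.sum_add_distrib, ← Finset.sum_sub_distrib]
      exact Finset.sum_nonneg fun i _ => by linarith [hf i i]
    have hm := Nat.find_min' hQ (m := (∑ i, u' i + ∑ i, v' i - ∑ i, w i i).toNat)
      ⟨u', v', hf, (Int.toNat_of_nonneg hnn).symm⟩
    omega
  obtain ⟨τ, hτ, hmem⟩ := (Finset.all_card_le_biUnion_card_iff_exists_injective T).1 hall
  exact ⟨u, v, τ, hτ, huv, fun i => by simpa [T] using hmem i⟩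

lemma egervary {r n : ℕ} (hrn : r ≤ n) (hn : 0 < n) (ε : Fin r → Fin n → ℕ) (m : ℕ)
    (hm : ∀ t j, m ≤ ε t j) :
    ∃ (u : Fin r → ℕ) (v : Fin n → ℕ), (∀ t j, ε t j ≤ u t + v j) ∧ (∀ t, m ≤ u t) ∧
      ∑ t, u t + ∑ j, v j ≤ jacobiN ε := by
  classical
  let w : Fin n → Fin n → ℤ := fun i j => if h : (i : ℕ) < r then (ε ⟨i, h⟩ j : ℤ) else 0
  obtain ⟨u, v, τ, hτ, huv, heq⟩ := egervary_sq w
  have hw0 : ∀ i j, 0 ≤ w i j := by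
    intro i j; simp only [w]; split_ifs <;> simp
  have : Nonempty (Fin n) := ⟨⟨0, hn⟩⟩
  obtain ⟨j0, hj0⟩ := Finite.exists_min v
  have hu0 : ∀ i, 0 ≤ u i + v j0 := fun i => (hw0 i j0).trans (huv i j0)
  have hwc : ∀ t j, w (Fin.castLE hrn t) j = ε t j := by
    intro t j; simp [w]
  refine ⟨fun t => (u (Fin.castLE hrn t) + v j0).toNat, fun j => (v j - v j0).toNat, ?_, ?_, ?_⟩
  · intro t j
    have h1 := huv (Fin.castLE hrn t) j
    rw [hwc] at h1
    have h2 := hu0 (Fin.castLE hrn t)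
    have h3 := hj0 j
    simp only
    omega
  · intro t
    have h1 := huv (Fin.castLE hrn t) j0
    rw [hwc] at h1
    have := hm t j0
    simp only
    omega
  · have hJ : ∑ t, ε t (τ (Fin.castLE hrn t)) ≤ jacobiN ε := by
      unfold jacobiN
      exact Finset.le_sup (f := fun τ : {τ : Fin r → Fin n // Function.Injective τ} => ∑ i, ε i (τ.1 i))
        (Finset.mem_univ (⟨fun t => τ (Fin.castLE hrn t), fun a b hab => Fin.castLE_injective hrn (hτ hab)⟩ : {τ : Fin r → Fin n // Function.Injective τ}))
    refine le_trans ?_ hJ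
    zify
    have e1 : ∀ t : Fin r, (((u (Fin.castLE hrn t) + v j0).toNat : ℕ) : ℤ) = u (Fin.castLE hrn t) + v j0 :=
      fun t => Int.toNat_of_nonneg (hu0 _)
    have e2 : ∀ j : Fin n, (((v j - v j0).toNat : ℕ) : ℤ) = v j - v j0 :=
      fun j => Int.toNat_of_nonneg (by linarith [hj0 j])
    simp only [e1, e2]
    have hbij : Function.Bijective τ := Finite.injective_iff_bijective.1 hτ
    have hsv : ∑ i, (v (τ i) - v j0) = ∑ j, (v j - v j0) := hbij.sum_comp (fun j => v j - v j0)
    have hsub : ∀ g : Fin n → ℤ, (∀ i : Fin n, ¬ (i : ℕ) < r → g i = 0) → ∑ t : Fin r, g (Fin.castLE hrn t) = ∑ i, g i := by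
      intro g hg
      have : ∑ t : Fin r, g (Fin.castLE hrn t) = ∑ i ∈ Finset.univ.map (Fin.castLEEmb hrn), g i := by
        rw [Finset.sum_map]; rfl
      rw [this]
      apply Finset.sum_subset (Finset.subset_univ _)
      intro i _ hi
      apply hg
      intro hlt
      exact hi (Finset.mem_map.2 ⟨⟨i, hlt⟩, Finset.mem_univ _, rfl⟩)
    have hA : ∑ t : Fin r, (ε t (τ (Fin.castLE hrn t)) : ℤ) = ∑ i, w i (τ i) := by
      rw [← hsub (fun i => w i (τ i)) (fun i hi => by simp [w, hi])]
      simp [hwc]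
    have hB : ∑ t : Fin r, (u (Fin.castLE hrn t) + v j0) ≤ ∑ i, (u i + v j0) := by
      have := Finset.sum_le_sum_of_subset_of_nonneg (f := fun i => u i + v j0)
        (Finset.subset_univ (Finset.univ.map (Fin.castLEEmb hrn))) (fun i _ _ => hu0 i)
      rw [Finset.sum_map] at this
      exact this
    rw [hA, ← hsv]
    calc _ ≤ ∑ i, (u i + v j0) + ∑ i, (v (τ i) - v j0) := by linarith
      _ = ∑ i, w i (τ i) := by
        rw [← Finset.sum_add_distrib]
        exact Finset.sum_congr rfl fun i _ => by rw [heq i]; ring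

/-- filtered comparison of subspaces -/
lemma finrank_filt {F ι : Type} [Field F] [Fintype ι] {k : ℕ}
    (V V' : Submodule F (Fin k × ι → F))
    (h : ∀ v ∈ V, ∀ m : Fin k, (∀ p t, m < p → v (p, t) = 0) →
      ∃ v' ∈ V', (∀ p t, m < p → v' (p, t) = 0) ∧ ∀ t, v' (m, t) = v (m, t)) :
    Module.finrank F V ≤ Module.finrank F V' := by
  let W : ℕ → Submodule F (Fin k × ι → F) := fun m =>
    { carrier := {v | ∀ p : Fin k, ∀ t, m ≤ (p : ℕ) → v (p, t) = 0}
      add_mem' := fun {a b} ha hb p t hp => by simp [ha p t hp, hb p t hp]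
      zero_mem' := fun p t hp => rfl
      smul_mem' := fun c a ha p t hp => by simp [ha p t hp] }
  have step : ∀ m ≤ k, Module.finrank F (V ⊓ W m : Submodule _ _) ≤ Module.finrank F (V' ⊓ W m : Submodule _ _) := by
    intro m
    induction m with
    | zero =>
      intro _
      have : V ⊓ W 0 = ⊥ := by
        rw [eq_bot_iff]
        rintro v ⟨_, hv⟩
        ext ⟨p, t⟩
        exact hv p t (Nat.zero_le _)
      rw [this]; simp
    | succ m ih =>
      intro hm
      have ih := ih (by omega)
      let m' : Fin k := ⟨m, by omega⟩
      let π : (Fin k × ι → F) →ₗ[F] (ι → F) := LinearMap.funLeft F F (fun t => (m', t))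
      have key : ∀ U : Submodule F (Fin k × ι → F), Module.finrank F (U ⊓ W (m+1) : Submodule _ _) =
          Module.finrank F ((U ⊓ W (m+1)).map π) + Module.finrank F (U ⊓ W m : Submodule _ _) := by
        intro U
        have h1 := LinearMap.finrank_range_add_finrank_ker (π.domRestrict (U ⊓ W (m+1)))
        rw [LinearMap.range_domRestrict] at h1
        rw [← h1]
        congr 1
        have h2 : U ⊓ W m = (LinearMap.ker (π.domRestrict (U ⊓ W (m+1)))).map (U ⊓ W (m+1)).subtype := by
          ext v
          simp only [Submodule.mem_map, LinearMap.mem_ker, Submodule.subtype_apply, Subtype.exists,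
            exists_and_right, exists_eq_right, LinearMap.domRestrict_apply]
          constructor
          · rintro ⟨hU, hW⟩
            refine ⟨⟨hU, fun p t hp => hW p t (by omega)⟩, ?_⟩
            ext t
            exact hW m' t le_rfl
          · rintro ⟨⟨hU, hW⟩, h0⟩
            refine ⟨hU, fun p t hp => ?_⟩
            rcases Nat.lt_or_ge m p with h | h
            · exact hW p t h
            · have : p = m' := Fin.ext (le_antisymm h hp)
              rw [this]
              exact congrFun h0 t
        rw [h2]
        exact (LinearEquiv.finrank_eq (Submodule.equivMapOfInjective (U ⊓ W (m+1)).subtype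
          (Submodule.injective_subtype _) (LinearMap.ker (π.domRestrict (U ⊓ W (m+1))))))
      rw [key V, key V']
      refine add_le_add (Submodule.finrank_mono ?_) ih
      rintro _ ⟨v, ⟨hv, hvW⟩, rfl⟩
      obtain ⟨v', hv', h0, h1⟩ := h v hv m' (fun p t hp => hvW p t hp)
      refine ⟨v', ⟨hv', fun p t hp => h0 p t hp⟩, ?_⟩
      ext t
      exact h1 t
  have hk := step k le_rfl
  have hW : W k = ⊤ := by
    rw [eq_top_iff]
    intro v _ p t hp
    omega
  rw [hW, inf_top_eq, inf_top_eq] at hk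
  exact hk

lemma finrank_leftker {F ι κ : Type} [Field F] [Fintype ι] [Fintype κ] (A : Matrix ι κ F) :
    A.rank + Module.finrank F (LinearMap.ker A.vecMulLinear) = Fintype.card ι := by
  classical
  have := LinearMap.finrank_range_add_finrank_ker A.vecMulLinear
  rw [Module.finrank_fintype_fun_eq_card] at this
  rw [← this, ← Matrix.rank_transpose]
  congr 1
  rw [Matrix.rank, Matrix.mulVecLin_transpose]

end DAE

namespace DAE

open MvPolynomial

section diff

variable {K : Type} [Field K] {n r : ℕ} {δ : K → K} {D : DP K n → DP K n}

lemma D_zero (hD : IsTotalDeriv K n δ D) : D 0 = 0 := by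
  have := hD.map_add 0 0
  simpa using this

lemma D_one (hD : IsTotalDeriv K n δ D) : D 1 = 0 := by
  have := hD.leibniz 1 1
  simpa using this

lemma pderiv_D (hD : IsTotalDeriv K n δ D) (j : Fin n) (l : ℕ) (g : DP K n) :
    pderiv (j, l + 1) (D g) = D (pderiv (j, l + 1) g) + pderiv (j, l) g := by
  induction g using MvPolynomial.induction_on with
  | C a => simp [hD.map_C, D_zero hD]
  | add p q hp hq => rw [hD.map_add, map_add, hp, hq, map_add, map_add, hD.map_add]; ring
  | mul_X p v hp =>
    obtain ⟨j', l'⟩ := v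
    have key : pderiv (j, l + 1) (X (j', l' + 1) : DP K n) = pderiv (j, l) (X (j', l')) := by
      by_cases h : (j', l') = (j, l)
      · rw [h, pderiv_X_self]
        obtain ⟨rfl, rfl⟩ := Prod.mk.inj h
        rw [pderiv_X_self]
      · rw [pderiv_X_of_ne h, pderiv_X_of_ne]
        intro h'
        apply h
        obtain ⟨h1, h2⟩ := Prod.mk.inj h'
        rw [h1, Nat.succ_injective h2]
    have key2 : D (pderiv (j, l + 1) (X (j', l') : DP K n)) = 0 := by
      by_cases h : (j', l') = (j, l + 1)
      · rw [h, pderiv_X_self, D_one hD]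
      · rw [pderiv_X_of_ne h, D_zero hD]
    rw [hD.leibniz, hD.map_X]
    simp only [map_add, pderiv_mul]
    rw [hD.map_add, hD.leibniz, hD.leibniz, hD.map_X, hp, key, key2]
    ring

lemma pderiv_iter (hD : IsTotalDeriv K n δ D) (g : DP K n) (j : Fin n) (p l : ℕ)
    (h : p + ordIn g j < l) : pderiv (j, l) (D^[p] g) = 0 := by
  induction p generalizing l with
  | zero =>
    apply pderiv_eq_zero_of_notMem_vars
    intro hm
    have : l ≤ ordIn g j := Finset.le_sup (f := fun v : Fin n × ℕ => v.2)
      (Finset.mem_filter.2 ⟨hm, rfl⟩ : (j, l) ∈ g.vars.filter fun v => v.1 = j)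
    omega
  | succ p ih =>
    obtain ⟨l, rfl⟩ : ∃ l', l = l' + 1 := ⟨l - 1, by omega⟩
    rw [Function.iterate_succ_apply', pderiv_D hD, ih (l + 1) (by omega), ih l (by omega), D_zero hD,
      add_zero]

lemma D_sum (hD : IsTotalDeriv K n δ D) {ι : Type} (s : Finset ι) (g : ι → DP K n) :
    D (∑ i ∈ s, g i) = ∑ i ∈ s, D (g i) :=
  map_sum (AddMonoidHom.mk' D hD.map_add) g s

lemma toKK_eq_zero (𝔓 : Ideal (DP K n)) [𝔓.IsPrime] (g : DP K n) : toKK 𝔓 g = 0 ↔ g ∈ 𝔓 := by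
  unfold toKK
  rw [RingHom.comp_apply, map_eq_zero_iff _ (IsFractionRing.injective (DP K n ⧸ 𝔓) (KK K n 𝔓)),
    Ideal.Quotient.eq_zero_iff_mem]

lemma clear_denoms (𝔓 : Ideal (DP K n)) [𝔓.IsPrime] {ι : Type} [Finite ι] (v : ι → KK K n 𝔓) :
    ∃ (a : KK K n 𝔓) (l : ι → DP K n), a ≠ 0 ∧ (∀ i, toKK 𝔓 (l i) = a * v i) ∧
      ∀ i, v i = 0 → l i = 0 := by
  classical
  obtain ⟨b, hb⟩ := IsLocalization.exist_integer_multiples_of_finite (nonZeroDivisors (DP K n ⧸ 𝔓)) v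
  have : ∀ i, ∃ g : DP K n, toKK 𝔓 g = algebraMap (DP K n ⧸ 𝔓) (KK K n 𝔓) b * v i := by
    intro i
    obtain ⟨x, hx⟩ := hb i
    obtain ⟨g, rfl⟩ := Ideal.Quotient.mk_surjective x
    refine ⟨g, ?_⟩
    rw [Algebra.smul_def] at hx
    exact hx
  choose g hg using this
  refine ⟨algebraMap (DP K n ⧸ 𝔓) (KK K n 𝔓) b, fun i => if v i = 0 then 0 else g i, ?_, ?_, ?_⟩
  · exact IsFractionRing.to_map_ne_zero_of_mem_nonZeroDivisors b.2
  · intro i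
    simp only
    split_ifs with h
    · simp [h]
    · exact hg i
  · intro i h; simp [h]

lemma Jmat_apply (f : Fin r → DP K n) (𝔓 : Ideal (DP K n)) [𝔓.IsPrime] {e : ℕ} (he1 : 1 ≤ e)
    (k h : ℕ) (p : Fin k × Fin r) (q : Fin k × Fin n) :
    Jmat D f 𝔓 e k (e - 1 + h) p q =
      toKK 𝔓 (pderiv (q.2, e + h + (q.1 : ℕ)) (D^[h + (p.1 : ℕ)] (f p.2))) := by
  unfold Jmat jEntry
  have h1 : e - 1 + h + 1 = e + h := by omega
  have h2 : e + h - e = h := by omega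
  rw [h1, h2]

lemma mem_leftker {F ι κ : Type} [Field F] [Fintype ι] [Fintype κ] (A : Matrix ι κ F) (v : ι → F) :
    v ∈ LinearMap.ker A.vecMulLinear ↔ ∀ q, ∑ p, v p * A p q = 0 := by
  rw [LinearMap.mem_ker, funext_iff]
  rfl

lemma shift_poly (hD : IsTotalDeriv K n δ D) (f : Fin r → DP K n) (𝔓 : Ideal (DP K n))
    (hdiff : IsDiffIdeal D 𝔓) {e : ℕ} (he : ∀ t j, ordIn (f t) j ≤ e) (k h : ℕ)
    (L : ℕ → Fin r → DP K n) (hL0 : ∀ p t, k ≤ p → L p t = 0)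
    (hL : ∀ q < k, ∀ j, ∑ t, ∑ p ∈ Finset.range k,
      L p t * pderiv (j, e + h + q) (D^[h + p] (f t)) ∈ 𝔓) (q : ℕ) (hq : q < k) (j : Fin n) :
    ∑ t, ∑ p ∈ Finset.range k,
      (L p t + D (L (p + 1) t)) * pderiv (j, e + (h + 1) + q) (D^[h + 1 + p] (f t)) ∈ 𝔓 := by
  have hG : ∀ p t, pderiv (j, e + (h + 1) + q) (D^[h + 1 + p] (f t)) =
      D (pderiv (j, e + h + (q + 1)) (D^[h + p] (f t))) + pderiv (j, e + h + q) (D^[h + p] (f t)) := by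
    intro p t
    have h1 : e + (h + 1) + q = (e + h + q) + 1 := by ring
    have h2 : h + 1 + p = (h + p) + 1 := by ring
    have h3 : e + h + (q + 1) = (e + h + q) + 1 := by ring
    rw [h1, h2, h3, Function.iterate_succ_apply', pderiv_D hD]
  have hS : ∀ t, ∑ p ∈ Finset.range k, D (L (p + 1) t) * pderiv (j, e + (h + 1) + q) (D^[h + 1 + p] (f t))
      = ∑ p ∈ Finset.range k, D (L p t) * pderiv (j, e + h + (q + 1)) (D^[h + p] (f t)) := by
    intro t
    let G : ℕ → DP K n := fun p => D (L p t) * pderiv (j, e + h + (q + 1)) (D^[h + p] (f t))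
    have e1 := Finset.sum_range_succ G k
    have e2 := Finset.sum_range_succ' G k
    have g0 : G 0 = 0 := by
      simp only [G]
      rw [pderiv_iter hD, mul_zero]
      have := he t j
      omega
    have gk : G k = 0 := by
      simp only [G]
      rw [hL0 k t le_rfl, D_zero hD, zero_mul]
    rw [gk, add_zero] at e1
    rw [g0, add_zero, e1] at e2
    rw [show ∑ p ∈ Finset.range k, D (L p t) * pderiv (j, e + h + (q + 1)) (D^[h + p] (f t)) = _ from e2]
    apply Finset.sum_congr rfl
    intro p _
    simp only [G]
    rw [show e + (h + 1) + q = e + h + (q + 1) by ring, show h + 1 + p = h + (p + 1) by ring]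
  have hT : ∑ t, ∑ p ∈ Finset.range k,
      (L p t + D (L (p + 1) t)) * pderiv (j, e + (h + 1) + q) (D^[h + 1 + p] (f t)) =
      D (∑ t, ∑ p ∈ Finset.range k, L p t * pderiv (j, e + h + (q + 1)) (D^[h + p] (f t))) +
      ∑ t, ∑ p ∈ Finset.range k, L p t * pderiv (j, e + h + q) (D^[h + p] (f t)) := by
    rw [D_sum hD, ← Finset.sum_add_distrib]
    apply Finset.sum_congr rfl
    intro t _
    simp only [add_mul, Finset.sum_add_distrib]
    rw [hS t, D_sum hD, ← Finset.sum_add_distrib, ← Finset.sum_add_distrib]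
    apply Finset.sum_congr rfl
    intro p _
    rw [hG, hD.leibniz]
    ring
  rw [hT]
  refine 𝔓.add_mem (hdiff _ ?_) (hL q hq j)
  by_cases hq' : q + 1 < k
  · exact hL (q + 1) hq' j
  · have : ∑ t, ∑ p ∈ Finset.range k, L p t * pderiv (j, e + h + (q + 1)) (D^[h + p] (f t)) = 0 := by
      apply Finset.sum_eq_zero
      intro t _
      apply Finset.sum_eq_zero
      intro p hp
      rw [pderiv_iter hD, mul_zero]
      have := he t j
      have := Finset.mem_range.1 hp
      omega
    rw [this]
    exact 𝔓.zero_mem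

lemma ker_shift (hD : IsTotalDeriv K n δ D) (f : Fin r → DP K n) (𝔓 : Ideal (DP K n)) [𝔓.IsPrime]
    (hdiff : IsDiffIdeal D 𝔓) {e : ℕ} (he1 : 1 ≤ e) (he : ∀ t j, ordIn (f t) j ≤ e) (k h : ℕ) :
    Module.finrank (KK K n 𝔓) (LinearMap.ker (Jmat D f 𝔓 e k (e - 1 + h)).vecMulLinear) ≤
    Module.finrank (KK K n 𝔓) (LinearMap.ker (Jmat D f 𝔓 e k (e - 1 + (h + 1))).vecMulLinear) := by
  apply finrank_filt
  intro v hv m hvm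
  obtain ⟨a, l, ha, hl, hl0⟩ := clear_denoms 𝔓 v
  let L : ℕ → Fin r → DP K n := fun p t => if hp : p < k then l (⟨p, hp⟩, t) else 0
  have hL : ∀ (p : Fin k) t, L p t = l (p, t) := fun p t => by simp [L]
  have hL0 : ∀ p t, k ≤ p → L p t = 0 := fun p t hp => by simp [L, not_lt.2 hp]
  have hLm : ∀ p t, (m : ℕ) < p → L p t = 0 := by
    intro p t hp
    by_cases h : p < k
    · have := hL ⟨p, h⟩ t
      simp only at this
      rw [this]
      exact hl0 _ (hvm _ t hp)
    · exact hL0 p t (not_lt.1 h)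
  rw [mem_leftker] at hv
  have hmem : ∀ q < k, ∀ j, ∑ t, ∑ p ∈ Finset.range k,
      L p t * pderiv (j, e + h + q) (D^[h + p] (f t)) ∈ 𝔓 := by
    intro q hq j
    rw [← toKK_eq_zero]
    have h1 := hv (⟨q, hq⟩, j)
    rw [Fintype.sum_prod_type_right] at h1
    have h2 : toKK 𝔓 (∑ t, ∑ p ∈ Finset.range k, L p t * pderiv (j, e + h + q) (D^[h + p] (f t))) =
        a * ∑ t, ∑ p, v (p, t) * Jmat D f 𝔓 e k (e - 1 + h) (p, t) (⟨q, hq⟩, j) := by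
      simp only [map_sum, map_mul, Finset.mul_sum]
      apply Finset.sum_congr rfl
      intro t _
      rw [Finset.sum_range]
      apply Finset.sum_congr rfl
      intro p _
      rw [hL, hl, Jmat_apply f 𝔓 he1, mul_assoc]
    rw [h2, h1, mul_zero]
  have hnew := shift_poly hD f 𝔓 hdiff he k h L hL0 hmem
  refine ⟨fun pt => a⁻¹ * toKK 𝔓 (L pt.1 pt.2 + D (L (pt.1 + 1) pt.2)), ?_, ?_, ?_⟩
  · rw [mem_leftker]
    rintro ⟨q, j⟩
    have h1 := (toKK_eq_zero 𝔓 _).2 (hnew q q.2 j)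
    rw [Fintype.sum_prod_type_right]
    have h2 : ∑ t, ∑ p : Fin k, a⁻¹ * toKK 𝔓 (L p t + D (L (p + 1) t)) *
          Jmat D f 𝔓 e k (e - 1 + (h + 1)) (p, t) (q, j) =
        a⁻¹ * toKK 𝔓 (∑ t, ∑ p ∈ Finset.range k,
      (L p t + D (L (p + 1) t)) * pderiv (j, e + (h + 1) + q) (D^[h + 1 + p] (f t))) := by
      simp only [map_sum, map_mul, Finset.mul_sum]
      apply Finset.sum_congr rfl
      intro t _
      rw [Finset.sum_range]
      apply Finset.sum_congr rfl
      intro p _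
      rw [Jmat_apply f 𝔓 he1, mul_assoc]
    rw [h1, mul_zero] at h2
    exact h2
  · intro p t hp
    have hp' : (m : ℕ) < p := hp
    simp only
    rw [hLm p t hp', hLm (p + 1) t (by omega), D_zero hD]
    simp
  · intro t
    simp only
    rw [hLm (m + 1) t (by omega), D_zero hD, add_zero, hL, hl, inv_mul_cancel_left₀ ha]

lemma ker_shift_le (hD : IsTotalDeriv K n δ D) (f : Fin r → DP K n) (𝔓 : Ideal (DP K n)) [𝔓.IsPrime]
    (hdiff : IsDiffIdeal D 𝔓) {e : ℕ} (he1 : 1 ≤ e) (he : ∀ t j, ordIn (f t) j ≤ e) (k h : ℕ) :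
    (Jmat D f 𝔓 e k (e - 1 + h)).rank ≤ (Jmat D f 𝔓 e k (e - 1)).rank := by
  have h1 : Module.finrank (KK K n 𝔓) (LinearMap.ker (Jmat D f 𝔓 e k (e - 1)).vecMulLinear) ≤
    Module.finrank (KK K n 𝔓) (LinearMap.ker (Jmat D f 𝔓 e k (e - 1 + h)).vecMulLinear) := by
    induction h with
    | zero => exact le_rfl
    | succ h ih => exact ih.trans (ker_shift hD f 𝔓 hdiff he1 he k h)
  have h2 := finrank_leftker (Jmat D f 𝔓 e k (e - 1))
  have h3 := finrank_leftker (Jmat D f 𝔓 e k (e - 1 + h))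
  omega

end diff

end DAE

namespace DAE

open MvPolynomial

section trdeg

variable {K : Type} [Field K] {n r : ℕ} {δ : K → K} {D : DP K n → DP K n}

lemma toKK_C (𝔓 : Ideal (DP K n)) [𝔓.IsPrime] (a : K) :
    toKK 𝔓 (C a) = algebraMap K (KK K n 𝔓) a := by
  rw [IsScalarTower.algebraMap_apply K (DP K n ⧸ 𝔓) (KK K n 𝔓)]
  rfl

lemma d_toKK (𝔓 : Ideal (DP K n)) [𝔓.IsPrime] (g : DP K n) (S : Finset (Fin n × ℕ))
    (hS : ∀ v, v ∉ S → pderiv v g = 0) :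
    KaehlerDifferential.D K (KK K n 𝔓) (toKK 𝔓 g) =
      ∑ v ∈ S, toKK 𝔓 (pderiv v g) • KaehlerDifferential.D K (KK K n 𝔓) (toKK 𝔓 (X v)) := by
  let b := KaehlerDifferential.mvPolynomialBasis K (Fin n × ℕ)
  have h1 := b.linearCombination_repr (KaehlerDifferential.D K (DP K n) g)
  rw [Finsupp.linearCombination_apply, Finsupp.sum_of_support_subset (s := S)] at h1
  · have h2 := congrArg (KaehlerDifferential.map K K (DP K n) (KK K n 𝔓)) h1
    rw [map_sum, KaehlerDifferential.map_D] at h2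
    refine Eq.trans h2.symm ?_
    apply Finset.sum_congr rfl
    intro v _
    rw [map_smul, KaehlerDifferential.mvPolynomialBasis_apply, KaehlerDifferential.map_D,
      KaehlerDifferential.mvPolynomialBasis_repr_apply, ← algebraMap_smul (KK K n 𝔓)]
    rfl
  · intro v hv
    by_contra hvS
    rw [Finsupp.mem_support_iff, KaehlerDifferential.mvPolynomialBasis_repr_apply] at hv
    exact hv (hS v hvS)
  · intro v _; simp

/-- the map `A_i → 𝕂` -/
def APtoKK (𝔓 : Ideal (DP K n)) [𝔓.IsPrime] (i : ℕ) : AP K n i →ₐ[K] KK K n 𝔓 :=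
  aeval fun v => toKK 𝔓 (X (v.1, (v.2 : ℕ)))

lemma APtoKK_apply (𝔓 : Ideal (DP K n)) [𝔓.IsPrime] (i : ℕ) (a : AP K n i) :
    APtoKK 𝔓 i a = toKK 𝔓 (inclA K n i a) := by
  induction a using MvPolynomial.induction_on with
  | C a => simp [APtoKK, inclA, toKK_C]
  | add p q hp hq => simp [hp, hq]
  | mul_X p v hp => rw [map_mul, map_mul, map_mul, hp]; simp [APtoKK, inclA]

lemma APtoKK_zero (𝔓 : Ideal (DP K n)) [𝔓.IsPrime] (i : ℕ) (a : AP K n i) :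
    APtoKK 𝔓 i a = 0 ↔ a ∈ Pc i 𝔓 := by
  rw [APtoKK_apply, toKK_eq_zero]; rfl

lemma exists_embed (𝔓 : Ideal (DP K n)) [𝔓.IsPrime] (i : ℕ) :
    ∃ φ : FractionRing (AP K n i ⧸ Pc i 𝔓) →ₐ[K] KK K n 𝔓,
      ∀ z, ∃ a b : AP K n i, φ z = APtoKK 𝔓 i a / APtoKK 𝔓 i b := by
  let g : (AP K n i ⧸ Pc i 𝔓) →ₐ[K] KK K n 𝔓 :=
    Ideal.Quotient.liftₐ (Pc i 𝔓) (APtoKK 𝔓 i) (fun a ha => (APtoKK_zero 𝔓 i a).2 ha)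
  have hgm : ∀ a, g (Ideal.Quotient.mk _ a) = APtoKK 𝔓 i a := fun a => rfl
  have hg : Function.Injective g := by
    rw [injective_iff_map_eq_zero]
    intro x hx
    obtain ⟨a, rfl⟩ := Ideal.Quotient.mk_surjective x
    rw [hgm, APtoKK_zero] at hx
    exact Ideal.Quotient.eq_zero_iff_mem.2 hx
  refine ⟨IsFractionRing.liftAlgHom hg, fun z => ?_⟩
  obtain ⟨x, y, hy, rfl⟩ := IsFractionRing.div_surjective (A := AP K n i ⧸ Pc i 𝔓) z
  obtain ⟨a, rfl⟩ := Ideal.Quotient.mk_surjective x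
  obtain ⟨b, rfl⟩ := Ideal.Quotient.mk_surjective y
  refine ⟨a, b, ?_⟩
  rw [map_div₀]
  simp only [IsFractionRing.liftAlgHom_apply, IsFractionRing.lift_algebraMap]
  rfl

lemma trdeg_le [CharZero K] (𝔓 : Ideal (DP K n)) [𝔓.IsPrime] (i d : ℕ)
    (h : HasTrdeg K (FractionRing (AP K n i ⧸ Pc i 𝔓)) d) :
    d ≤ Module.finrank (KK K n 𝔓) (LinearMap.range (Fintype.linearCombination (KK K n 𝔓)
      (fun v : Fin n × Fin (i + 1) =>
        KaehlerDifferential.D K (KK K n 𝔓) (toKK 𝔓 (X (v.1, (v.2 : ℕ))))))) := by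
  obtain ⟨s, hs, rfl⟩ := h
  obtain ⟨φ, hφ⟩ := exists_embed 𝔓 i
  set ψ := Fintype.linearCombination (KK K n 𝔓)
      (fun v : Fin n × Fin (i + 1) =>
        KaehlerDifferential.D K (KK K n 𝔓) (toKK 𝔓 (X (v.1, (v.2 : ℕ))))) with hψ
  have hX : ∀ v : Fin n × Fin (i + 1),
      KaehlerDifferential.D K (KK K n 𝔓) (toKK 𝔓 (X (v.1, (v.2 : ℕ)))) ∈ LinearMap.range ψ := by
    intro v
    classical
    refine ⟨Pi.single v 1, ?_⟩
    rw [hψ, Fintype.linearCombination_apply_single, one_smul]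
  have hA : ∀ a : AP K n i, KaehlerDifferential.D K (KK K n 𝔓) (APtoKK 𝔓 i a) ∈ LinearMap.range ψ := by
    intro a
    induction a using MvPolynomial.induction_on with
    | C a =>
      have : APtoKK 𝔓 i (C a) = algebraMap K _ a := by simp [APtoKK]
      rw [this, Derivation.map_algebraMap]
      exact Submodule.zero_mem _
    | add p q hp hq => rw [map_add, map_add]; exact Submodule.add_mem _ hp hq
    | mul_X p v hp =>
      have : APtoKK 𝔓 i (X v) = toKK 𝔓 (X (v.1, (v.2 : ℕ))) := by simp [APtoKK]
      rw [map_mul, Derivation.leibniz, this]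
      exact Submodule.add_mem _ (Submodule.smul_mem _ _ (hX v)) (Submodule.smul_mem _ _ hp)
  have hZ : ∀ z, KaehlerDifferential.D K (KK K n 𝔓) (φ z) ∈ LinearMap.range ψ := by
    intro z
    obtain ⟨a, b, hab⟩ := hφ z
    rw [hab, Derivation.leibniz_div]
    exact Submodule.smul_mem _ _ (Submodule.sub_mem _ (Submodule.smul_mem _ _ (hA a))
      (Submodule.smul_mem _ _ (hA b)))
  have hind : AlgebraicIndependent K (fun x : {x // x ∈ s} => φ x.1) :=
    hs.1.map' (f := φ) φ.toRingHom.injective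
  have hlin := linInd_D _ hind
  have hlin' : LinearIndependent (KK K n 𝔓) (fun x : {x // x ∈ s} =>
      (⟨KaehlerDifferential.D K (KK K n 𝔓) (φ x.1), hZ _⟩ : LinearMap.range ψ)) := by
    apply LinearIndependent.of_comp (LinearMap.range ψ).subtype
    exact hlin
  have := hlin'.fintype_card_le_finrank
  rwa [Fintype.card_coe] at this

lemma main_ineq [CharZero K] (hD : IsTotalDeriv K n δ D) (f : Fin r → DP K n) (𝔓 : Ideal (DP K n)) [𝔓.IsPrime]
    (hdiff : IsDiffIdeal D 𝔓) (hf : ∀ t, f t ∈ 𝔓) {e : ℕ} (he1 : 1 ≤ e) (he : ∀ t j, ordIn (f t) j ≤ e)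
    (hqr : IsQuasiRegularAt D f 𝔓 e) (k i d h : ℕ) (hi : i + 1 = e + h) (hh : 1 ≤ h)
    (htr : HasTrdeg K (FractionRing (AP K n i ⧸ Pc i 𝔓)) d) :
    d + r * (h + k) ≤ n * (i + 1) + (Jmat D f 𝔓 e k i).rank := by
  classical
  have hle : i + 1 ≤ h + k + e := by omega
  set Q := qrJac D f 𝔓 e (h + k) with hQ
  set J := Jmat D f 𝔓 e k i with hJ
  have hJa : ∀ p q, J p q = toKK 𝔓 (pderiv (q.2, e + h + (q.1 : ℕ)) (D^[h + (p.1 : ℕ)] (f p.2))) := by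
    intro p q
    have : i = e - 1 + h := by omega
    subst this
    exact Jmat_apply f 𝔓 he1 k h p q
  let Qc : Matrix (Fin r × Fin (h + k)) (Fin k × Fin n) (KK K n 𝔓) :=
    Matrix.of fun p q => Q p (q.2, ⟨e + h + q.1, by have := q.1.2; omega⟩)
  let E : Matrix (Fin r × Fin (h + k)) (Fin k × Fin r) (KK K n 𝔓) :=
    Matrix.of fun p s => if (p.2 : ℕ) = h + s.1 ∧ p.1 = s.2 then 1 else 0
  have hQE : Qc = E * J := by
    ext ⟨t, p⟩ ⟨q, j⟩
    rw [Matrix.mul_apply]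
    simp only [Qc, E, Matrix.of_apply, hQ, qrJac, hJa]
    by_cases hp : (p : ℕ) < h
    · rw [pderiv_iter hD, map_zero]
      · symm
        apply Finset.sum_eq_zero
        rintro ⟨p', t'⟩ _
        rw [if_neg (by simp only; omega), zero_mul]
      · have := he t j
        omega
    · rw [Finset.sum_eq_single ((⟨p - h, by omega⟩ : Fin k), t)]
      · have : h + ((p : ℕ) - h) = p := by omega
        simp [this]
      · rintro ⟨p', t'⟩ _ hne
        rw [if_neg, zero_mul]
        rintro ⟨h1, h2⟩
        apply hne
        simp only at h1 h2
        rw [h2]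
        congr 1
        exact Fin.ext (by simp only; omega)
      · simp
  have hrank : Qc.rank ≤ J.rank := by rw [hQE]; exact Matrix.rank_mul_le_right _ _
  let U := LinearMap.ker Qc.vecMulLinear
  have hU := finrank_leftker Qc
  have hQ0 : LinearMap.ker Q.vecMulLinear = ⊥ := by
    have h1 := finrank_leftker Q
    have h2 : Q.rank = r * (h + k) := hqr (h + k) (by omega)
    rw [h2] at h1
    simp only [Fintype.card_prod, Fintype.card_fin] at h1
    apply Submodule.finrank_eq_zero.1
    omega
  let dX : Fin n × ℕ → Ω[KK K n 𝔓⁄K] := fun v => KaehlerDifferential.D K (KK K n 𝔓) (toKK 𝔓 (X v))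
  let ι : Fin n × Fin (i + 1) → Fin n × Fin (h + k + e) := fun v => (v.1, Fin.castLE hle v.2)
  have hι : Function.Injective ι := by
    rintro ⟨a, b⟩ ⟨c, d⟩ hab
    simp only [ι, Prod.mk.injEq] at hab
    rw [hab.1, Fin.castLE_injective hle hab.2]
  let θ : (Fin r × Fin (h + k) → KK K n 𝔓) →ₗ[KK K n 𝔓] (Fin n × Fin (i + 1) → KK K n 𝔓) :=
    (LinearMap.funLeft _ _ ι).comp Q.vecMulLinear
  let ψ := Fintype.linearCombination (KK K n 𝔓)
      (fun v : Fin n × Fin (i + 1) => dX (v.1, (v.2 : ℕ)))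
  have hzero : ∀ l ∈ U, ∀ v : Fin n × Fin (h + k + e), v ∉ Set.range ι → Q.vecMulLinear l v = 0 := by
    intro l hl v hv
    obtain ⟨j, q⟩ := v
    have hq : i + 1 ≤ (q : ℕ) := by
      by_contra hlt
      exact hv ⟨(j, ⟨q, by omega⟩), rfl⟩
    have h1 := congrFun (LinearMap.mem_ker.1 hl) ((⟨q - (e + h), by have := q.2; omega⟩ : Fin k), j)
    have h2 : (⟨e + h + (q - (e + h)), by have := q.2; omega⟩ : Fin (h + k + e)) = q :=
      Fin.ext (by simp only; omega)
    have h3 : Qc.vecMulLinear l ((⟨q - (e + h), by have := q.2; omega⟩ : Fin k), j) =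
        Q.vecMulLinear l (j, ⟨e + h + (q - (e + h)), by have := q.2; omega⟩) := rfl
    rw [h3, h2] at h1
    exact h1
  have hinj : Function.Injective (θ.domRestrict U) := by
    rw [injective_iff_map_eq_zero]
    rintro ⟨l, hl⟩ h0
    have h1 : l ∈ LinearMap.ker Q.vecMulLinear := by
      rw [LinearMap.mem_ker]
      ext v
      by_cases hv : v ∈ Set.range ι
      · obtain ⟨w, rfl⟩ := hv
        exact congrFun h0 w
      · exact hzero l hl v hv
    rw [hQ0] at h1
    exact Subtype.ext h1
  have hDk : ∀ p t, D^[p] (f t) ∈ 𝔓 := by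
    intro p t
    induction p with
    | zero => exact hf t
    | succ p ih => rw [Function.iterate_succ_apply']; exact hdiff _ ih
  have hker : U.map θ ≤ LinearMap.ker ψ := by
    rintro _ ⟨l, hl, rfl⟩
    rw [LinearMap.mem_ker]
    have h1 : ψ (θ l) = ∑ v : Fin n × Fin (h + k + e), Q.vecMulLinear l v • dX (v.1, (v.2 : ℕ)) := by
      simp only [ψ, Fintype.linearCombination_apply]
      apply Fintype.sum_of_injective ι hι
      · intro v hv
        rw [hzero l hl v hv, zero_smul]
      · intro v; rfl
    rw [h1]
    have h2 : ∀ v, Q.vecMulLinear l v = ∑ p, l p * Q p v := fun v => rfl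
    simp only [h2, Finset.sum_smul]
    rw [Finset.sum_comm]
    apply Finset.sum_eq_zero
    rintro ⟨t, p⟩ _
    simp only [mul_smul, ← Finset.smul_sum]
    have h3 := d_toKK 𝔓 (D^[p] (f t))
      (Finset.univ.map ⟨fun v : Fin n × Fin (h + k + e) => ((v.1, (v.2 : ℕ)) : Fin n × ℕ), by
        rintro ⟨a, b⟩ ⟨c, d⟩ hab
        simp only [Prod.mk.injEq] at hab
        rw [hab.1, Fin.ext hab.2]⟩) (by
        rintro ⟨j, l⟩ hv
        apply pderiv_iter hD
        by_contra hlt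
        apply hv
        rw [Finset.mem_map]
        have := he t j
        have := p.2
        exact ⟨(j, ⟨l, by omega⟩), Finset.mem_univ _, rfl⟩)
    rw [(toKK_eq_zero 𝔓 _).2 (hDk p t), map_zero, Finset.sum_map] at h3
    have h4 : ∑ v, Q (t, p) v • dX (v.1, (v.2 : ℕ)) = 0 := h3.symm
    rw [h4, smul_zero]
  have f1 : Module.finrank (KK K n 𝔓) U ≤ Module.finrank (KK K n 𝔓) (LinearMap.ker ψ) := by
    rw [← LinearMap.finrank_range_of_inj hinj, LinearMap.range_domRestrict]
    exact Submodule.finrank_mono hker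
  have f2 := LinearMap.finrank_range_add_finrank_ker ψ
  have f3 := trdeg_le 𝔓 i d htr
  rw [Module.finrank_fintype_fun_eq_card] at f2
  simp only [Fintype.card_prod, Fintype.card_fin] at f2 hU
  have f4 : d ≤ Module.finrank (KK K n 𝔓) (LinearMap.range ψ) := f3
  have f5 : Qc.rank + Module.finrank (KK K n 𝔓) U = r * (h + k) := hU
  omega

lemma upper [CharZero K] (hrn : r ≤ n) (hD : IsTotalDeriv K n δ D) (f : Fin r → DP K n) (𝔓 : Ideal (DP K n)) [𝔓.IsPrime]
    (hdiff : IsDiffIdeal D 𝔓) (hf : ∀ t, f t ∈ 𝔓) {e : ℕ} (he1 : 1 ≤ e) (he : ∀ t j, ordIn (f t) j ≤ e)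
    (hqr : IsQuasiRegularAt D f 𝔓 e) (k c i₀ : ℕ)
    (hord : ∀ i : ℕ, i₀ ≤ i →
      HasTrdeg K (FractionRing (AP K n i ⧸ Pc i 𝔓)) ((n - r) * (i + 1) + c)) :
    (mu D f 𝔓 e k (e - 1) : ℤ) ≤ (e : ℤ) * r - c := by
  have h1 := main_ineq hD f 𝔓 hdiff hf he1 he hqr k (e - 1 + (i₀ + 1)) _ (i₀ + 1) (by omega) (by omega)
    (hord (e - 1 + (i₀ + 1)) (by omega))
  have h2 := ker_shift_le hD f 𝔓 hdiff he1 he k (i₀ + 1)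
  have h3 : (Jmat D f 𝔓 e k (e - 1)).rank ≤ k * r := by
    have := Matrix.rank_le_card_height (Jmat D f 𝔓 e k (e - 1))
    simpa using this
  unfold mu
  rw [Nat.cast_sub h3]
  obtain ⟨m, rfl⟩ := Nat.exists_eq_add_of_le hrn
  have h4 : e - 1 + (i₀ + 1) + 1 = e + (i₀ + 1) := by omega
  rw [h4, Nat.add_sub_cancel_left] at h1
  have h5 := h1.trans (Nat.add_le_add_left h2 _)
  zify at h5
  push_cast
  nlinarith [h5]

lemma lower (hrn : r ≤ n) (hD : IsTotalDeriv K n δ D) (f : Fin r → DP K n) (𝔓 : Ideal (DP K n)) [𝔓.IsPrime]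
    {e : ℕ} (hn : 0 < n) (he1 : 1 ≤ e) (k m : ℕ) (hm : ∀ t j, m ≤ ordIn (f t) j) (hk : e - m ≤ k) :
    (e : ℤ) * r - jacobiN (fun t j => ordIn (f t) j) ≤ (mu D f 𝔓 e k (e - 1) : ℤ) := by
  classical
  obtain ⟨u, v, huv, hmu, hsum⟩ := egervary hrn hn (fun t j => ordIn (f t) j) m hm
  let R : Finset (Fin k × Fin r) := Finset.univ.filter fun p => e ≤ (p.1 : ℕ) + u p.2
  let C : Finset (Fin k × Fin n) := Finset.univ.filter fun q => (q.1 : ℕ) < v q.2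
  have hcov := rank_cover (Jmat D f 𝔓 e k (e - 1)) R C (by
    rintro ⟨p, t⟩ ⟨q, j⟩ hp hq
    have h1 := Jmat_apply (D := D) f 𝔓 he1 k 0 (p, t) (q, j)
    simp only [add_zero, zero_add] at h1
    rw [h1, pderiv_iter hD, map_zero]
    simp only [R, C, Finset.mem_filter, Finset.mem_univ, true_and, not_le, not_lt] at hp hq
    have := huv t j
    omega)
  have hR : (R.card : ℤ) ≤ ∑ t, ((k : ℤ) - e + u t) := by
    have : R.card = ∑ t, (Finset.univ.filter fun p : Fin k => e ≤ (p : ℕ) + u t).card := by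
      simp only [R, Finset.card_filter]
      rw [Fintype.sum_prod_type_right]
    rw [this]
    push_cast
    apply Finset.sum_le_sum
    intro t _
    have h1 : (Finset.univ.filter fun p : Fin k => e ≤ (p : ℕ) + u t).card ≤ (Finset.Ico (e - u t) k).card := by
      refine Finset.card_le_card_of_injOn (fun p => (p : ℕ)) ?_ (fun a _ b _ hab => Fin.ext hab)
      intro p hp
      have hp' : e ≤ (p : ℕ) + u t := by simpa using hp
      have := p.2
      simp only [Finset.coe_Ico, Set.mem_Ico]
      omega
    rw [Nat.card_Ico] at h1
    have := hmu t
    omega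
  have hC : C.card ≤ ∑ j, v j := by
    have : C.card = ∑ j, (Finset.univ.filter fun p : Fin k => (p : ℕ) < v j).card := by
      simp only [C, Finset.card_filter]
      rw [Fintype.sum_prod_type_right]
    rw [this]
    apply Finset.sum_le_sum
    intro j _
    have h1 : (Finset.univ.filter fun p : Fin k => (p : ℕ) < v j).card ≤ (Finset.range (v j)).card := by
      refine Finset.card_le_card_of_injOn (fun p => (p : ℕ)) ?_ (fun a _ b _ hab => Fin.ext hab)
      intro p hp
      simpa using hp
    simpa using h1
  have h3 : (Jmat D f 𝔓 e k (e - 1)).rank ≤ k * r := by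
    have := Matrix.rank_le_card_height (Jmat D f 𝔓 e k (e - 1))
    simpa using this
  unfold mu
  rw [Nat.cast_sub h3]
  rw [Finset.sum_add_distrib, Finset.sum_const, Finset.card_univ, Fintype.card_fin, nsmul_eq_mul] at hR
  zify at hsum hC hcov
  push_cast
  nlinarith

end trdeg

end DAE

namespace DAE

open MvPolynomial

/-- Let `𝓔₀` be the `r×n` matrix with entries
`ε_{tj} = ord_{X_j}(f_t)` (set to `0` when `X_j` does not appear in `f_t`). Then for
every `k ≥ e − min ε_{tj}` one has `er − J(𝓔₀) ≤ μ_k ≤ er − ord(𝔓)` (the order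
`ord 𝔓` being encoded by the constant `c` of the Hilbert–Kolchin polynomial). -/
theorem mu_bounds
    {K : Type} [Field K] [CharZero K] {n r : ℕ} (hrn : r ≤ n)
    (δ : K → K) (hδ : IsDeriv K δ)
    (D : DP K n → DP K n) (hD : IsTotalDeriv K n δ D)
    (f : Fin r → DP K n)
    (e : ℕ) (he : e = Finset.univ.sup fun p : Fin r × Fin n => ordIn (f p.1) p.2)
    (he1 : 1 ≤ e)
    (𝔓 : Ideal (DP K n)) [𝔓.IsPrime]
    (hmin : IsMinimalPrimeDiff D f 𝔓)
    (hqr : IsQuasiRegularAt D f 𝔓 e)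
    (hsr : StandingRank D f 𝔓 e)
    (c : ℕ)
    (hord : ∃ i₀ : ℕ, ∀ i : ℕ, i₀ ≤ i →
      HasTrdeg K (FractionRing (AP K n i ⧸ Pc i 𝔓)) ((n - r) * (i + 1) + c)) :
    ∀ k : ℕ, e - sInf (Set.range fun p : Fin r × Fin n => ordIn (f p.1) p.2) ≤ k →
      (e : ℤ) * r - jacobiN (fun t j => ordIn (f t) j) ≤ (mu D f 𝔓 e k (e - 1) : ℤ) ∧
      (mu D f 𝔓 e k (e - 1) : ℤ) ≤ (e : ℤ) * r - c := by
  have hr : 0 < r := by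
    rcases Nat.eq_zero_or_pos r with h | h
    · subst h; simp at he; omega
    · exact h
  have hle : ∀ t j, ordIn (f t) j ≤ e := fun t j => by
    rw [he]
    exact Finset.le_sup (f := fun p : Fin r × Fin n => ordIn (f p.1) p.2) (Finset.mem_univ (t, j))
  obtain ⟨i₀, hi₀⟩ := hord
  intro k hk
  exact ⟨lower hrn hD f 𝔓 (by omega) he1 k (sInf (Set.range fun p : Fin r × Fin n => ordIn (f p.1) p.2))
      (fun t j => Nat.sInf_le (Set.mem_range_self (f := fun p : Fin r × Fin n => ordIn (f p.1) p.2) (t, j))) hk,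
    upper hrn hD f 𝔓 hmin.2.1 hmin.2.2.1 he1 hle hqr k c i₀ hi₀⟩

end DAE
end
end

section
/- Let A ∈ ℕ₀^{s×m} with s ≤ m. Then for every positive integer k ≥ max_{i,j}{a_{ij}}, the equality J(A) = J(T_k(A)) holds. -/
open scoped Classical

noncomputable section

namespace JacobiBound

/-- the Jacobi number of a matrix of natural numbers:
`J(M) := max { Σ_i M i (τ i) : τ injective }` -/
def jacobiN {ι κ : Type} [Fintype ι] [Fintype κ] [DecidableEq ι] [DecidableEq κ]
    (M : ι → κ → ℕ) : ℕ :=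
  Finset.univ.sup fun τ : {τ : ι → κ // Function.Injective τ} => ∑ i, M i (τ.1 i)

/-- the `k×k` lower triangular binary matrix `T_{k,a}` (`0 ≤ a ≤ k`), whose `a` lowest
diagonals (in `1`-based indexing, entries `(h,l)` with `k−a ≤ h−l ≤ k−1`) are filled
with `1`'s and whose remaining entries are `0`; here `h l : Fin k` are `0`-based. -/
def Tka (k a : ℕ) (h l : Fin k) : ℕ :=
  if (l : ℕ) ≤ (h : ℕ) ∧ k - a ≤ (h : ℕ) - (l : ℕ) then 1 else 0

/-- the `ks×km` block matrix `T_k(A)` whose `(i,j)` block is `T_{k, a_{ij}}` -/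
def TkA {s m : ℕ} (A : Fin s → Fin m → ℕ) (k : ℕ) :
    Fin s × Fin k → Fin m × Fin k → ℕ :=
  fun p q => Tka k (A p.1 q.1) p.2 q.2

theorem egervary {α : Type} [Fintype α] [DecidableEq α] (B : α → α → ℕ) (N : ℕ) :
    ∀ u v : α → ℕ, (∀ i j, B i j ≤ u i + v j) → ∑ i, u i + ∑ j, v j = N →
    ∃ u v : α → ℕ, (∀ i j, B i j ≤ u i + v j) ∧
      ∃ σ : α → α, Function.Injective σ ∧ ∀ i, B i (σ i) = u i + v (σ i) := by
  induction N using Nat.strong_induction_on with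
  | _ N ih =>
  intro u v huv hN
  let t : α → Finset α := fun i => Finset.univ.filter fun j => B i j = u i + v j
  by_cases hall : ∀ S : Finset α, S.card ≤ (S.biUnion t).card
  · obtain ⟨σ, hσ, h⟩ := (Finset.all_card_le_biUnion_card_iff_exists_injective t).1 hall
    refine ⟨u, v, huv, σ, hσ, fun i => ?_⟩
    have := h i
    simpa [t] using this
  push Not at hall
  obtain ⟨S, hS⟩ := hall
  set T := S.biUnion t with hT
  have strict : ∀ i ∈ S, ∀ j, j ∉ T → B i j < u i + v j := by
    intro i hi j hj
    refine lt_of_le_of_ne (huv i j) fun h => hj ?_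
    rw [hT, Finset.mem_biUnion]
    exact ⟨i, hi, by simp [t, h]⟩
  by_cases hpos : ∀ i ∈ S, 0 < u i
  · let u' : α → ℕ := fun i => u i - if i ∈ S then 1 else 0
    let v' : α → ℕ := fun j => v j + if j ∈ T then 1 else 0
    have h1 : ∑ i, u' i + S.card = ∑ i, u i := by
      have : S.card = ∑ i, if i ∈ S then 1 else 0 := by simp
      rw [this, ← Finset.sum_add_distrib]
      refine Finset.sum_congr rfl fun i _ => ?_
      have := hpos i
      simp only [u']
      split_ifs with h
      · have := this h
        omega
      · omega
    have h2 : ∑ j, v' j = ∑ j, v j + T.card := by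
      simp [v', Finset.sum_add_distrib]
    refine ih (∑ i, u' i + ∑ j, v' j) (by omega) u' v' (fun i j => ?_) rfl
    have a1 := huv i j
    have a2 := strict i
    have a3 := hpos i
    simp only [u', v']
    by_cases hi : i ∈ S <;> by_cases hj : j ∈ T <;> simp only [hi, hj, if_true, if_false]
    · omega
    · have := a2 hi j hj
      omega
    · omega
    · omega
  · push Not at hpos
    obtain ⟨i0, hi0, hu0⟩ := hpos
    have hv : ∀ j, j ∉ T → 0 < v j := by
      intro j hj
      have := strict i0 hi0 j hj
      omega
    let u' : α → ℕ := fun i => u i + if i ∈ S then 0 else 1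
    let v' : α → ℕ := fun j => v j - if j ∈ T then 0 else 1
    have h1 : ∑ i, u' i + S.card = ∑ i, u i + Fintype.card α := by
      have e1 : S.card = ∑ i, if i ∈ S then 1 else 0 := by simp
      have e2 : Fintype.card α = ∑ i : α, 1 := by simp
      rw [e1, e2, ← Finset.sum_add_distrib, ← Finset.sum_add_distrib]
      refine Finset.sum_congr rfl fun i _ => ?_
      simp only [u']
      split_ifs <;> omega
    have h2 : ∑ j, v' j + Fintype.card α = ∑ j, v j + T.card := by
      have e1 : T.card = ∑ i, if i ∈ T then 1 else 0 := by simp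
      have e2 : Fintype.card α = ∑ i : α, 1 := by simp
      rw [e1, e2, ← Finset.sum_add_distrib, ← Finset.sum_add_distrib]
      refine Finset.sum_congr rfl fun j _ => ?_
      have := hv j
      simp only [v']
      split_ifs with h
      · omega
      · have := this h
        omega
    refine ih (∑ i, u' i + ∑ j, v' j) (by omega) u' v' (fun i j => ?_) rfl
    have a1 := huv i j
    have a2 := strict i
    have a3 := hv j
    simp only [u', v']
    by_cases hi : i ∈ S <;> by_cases hj : j ∈ T <;> simp only [hi, hj, if_true, if_false]
    · omega
    · have := a2 hi j hj
      omega
    · omega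
    · omega

theorem count_lt (k a : ℕ) : (∑ l : Fin k, if (l : ℕ) < a then 1 else 0) ≤ a := by
  rw [Fin.sum_univ_eq_sum_range (fun l => if l < a then 1 else 0) k, ← Finset.card_filter]
  calc _ ≤ (Finset.range a).card := Finset.card_le_card (fun x hx => by
          simp at hx ⊢; exact hx.2)
    _ = a := by simp

theorem count_ge (k a : ℕ) : (∑ h : Fin k, if k ≤ (h : ℕ) + a then 1 else 0) ≤ a := by
  rw [Fin.sum_univ_eq_sum_range (fun l => if k ≤ l + a then 1 else 0) k, ← Finset.card_filter]
  calc _ ≤ (Finset.Ico (k - a) k).card := Finset.card_le_card (fun x hx => by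
          simp at hx ⊢; omega)
    _ ≤ a := by simp; omega

theorem count_ge' (k a : ℕ) (ha : a ≤ k) :
    a ≤ (∑ h : Fin k, if k ≤ (h : ℕ) + a then 1 else 0) := by
  rw [Fin.sum_univ_eq_sum_range (fun l => if k ≤ l + a then 1 else 0) k, ← Finset.card_filter]
  calc a ≤ (Finset.Ico (k - a) k).card := by simp; omega
    _ ≤ _ := Finset.card_le_card (fun x hx => by
          simp at hx ⊢; omega)

theorem le_jacobiN {ι κ : Type} [Fintype ι] [Fintype κ] [DecidableEq ι] [DecidableEq κ]
    (M : ι → κ → ℕ) (τ : ι → κ) (h : Function.Injective τ) : ∑ i, M i (τ i) ≤ jacobiN M := by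
  unfold jacobiN
  exact Finset.le_sup (f := fun τ : {τ : ι → κ // Function.Injective τ} => ∑ i, M i (τ.1 i))
    (Finset.mem_univ ⟨τ, h⟩)

theorem exists_cover {s m : ℕ} (hsm : s ≤ m) (A : Fin s → Fin m → ℕ) :
    ∃ (u : Fin s → ℕ) (v : Fin m → ℕ), (∀ i j, A i j ≤ u i + v j) ∧
      ∑ i, u i + ∑ j, v j ≤ jacobiN A := by
  let B : Fin m → Fin m → ℕ := fun i j => if h : (i : ℕ) < s then A ⟨i, h⟩ j else 0
  obtain ⟨u, v, huv, σ, hσ, ht⟩ := egervary B _ (fun i => ∑ j, B i j) (fun _ => 0)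
    (fun i j => by
      simpa using Finset.single_le_sum (f := fun j => B i j) (fun _ _ => Nat.zero_le _)
        (Finset.mem_univ j)) rfl
  refine ⟨fun i => u (Fin.castLE hsm i), v, fun i j => ?_, ?_⟩
  · simpa [B] using huv (Fin.castLE hsm i) j
  · have h1 : ∑ i : Fin s, u (Fin.castLE hsm i) ≤ ∑ i, u i := by
      refine (Finset.sum_map Finset.univ (Fin.castLEEmb hsm) u).symm.le.trans ?_
      exact Finset.sum_le_sum_of_subset (Finset.subset_univ _)
    have h2 : ∑ i, v (σ i) = ∑ j, v j :=
      (Equiv.ofBijective σ (Finite.injective_iff_bijective.1 hσ)).sum_comp v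
    have h3 : ∑ i, B i (σ i) = ∑ i, u i + ∑ j, v j := by
      rw [← h2, ← Finset.sum_add_distrib]
      exact Finset.sum_congr rfl fun i _ => ht i
    have h4 : ∑ i, B i (σ i) = ∑ i : Fin s, A i (σ (Fin.castLE hsm i)) := by
      have : ∑ i : Fin s, A i (σ (Fin.castLE hsm i))
          = ∑ i ∈ Finset.univ.map (Fin.castLEEmb hsm), B i (σ i) := by
        rw [Finset.sum_map]
        refine Finset.sum_congr rfl fun i _ => ?_
        simp [B]
      rw [this]
      symm
      refine Finset.sum_subset (Finset.subset_univ _) fun i _ hi => ?_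
      have : ¬ (i : ℕ) < s := fun h => hi (by
        rw [Finset.mem_map]
        exact ⟨⟨i, h⟩, Finset.mem_univ _, by ext; simp⟩)
      simp [B, this]
    have h5 := le_jacobiN A (fun i => σ (Fin.castLE hsm i))
      (hσ.comp (Fin.castLE_injective hsm))
    show ∑ i : Fin s, u (Fin.castLE hsm i) + ∑ j, v j ≤ _
    omega

/-- For `A ∈ ℕ₀^{s×m}` with `s ≤ m` and every positive integer
`k ≥ max_{i,j} a_{ij}`, one has `J(A) = J(T_k(A))`. -/
theorem jacobiN_eq_jacobiN_TkA {s m : ℕ} (hsm : s ≤ m) (A : Fin s → Fin m → ℕ)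
    (k : ℕ) (hk : 1 ≤ k) (hka : ∀ i j, A i j ≤ k) :
    jacobiN A = jacobiN (TkA A k) := by
  apply le_antisymm
  · have hsup : ∀ τ : {τ : Fin s → Fin m // Function.Injective τ},
        ∑ i, A i (τ.1 i) ≤ jacobiN (TkA A k) := by
      rintro ⟨τ, hτ⟩
      let ρ : Fin s × Fin k → Fin m × Fin k := fun p =>
        (τ p.1, ⟨(p.2 + A p.1 (τ p.1)) % k, Nat.mod_lt _ hk⟩)
      have hρ : Function.Injective ρ := by
        rintro ⟨i, h⟩ ⟨i', h'⟩ e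
        simp only [ρ, Prod.mk.injEq, Fin.mk.injEq] at e
        obtain ⟨e1, e2⟩ := e
        have := hτ e1
        subst this
        have e3 : (h : ℕ) ≡ h' [MOD k] := Nat.ModEq.add_right_cancel' _ e2
        have e4 : (h : ℕ) = h' := Nat.ModEq.eq_of_lt_of_lt e3 h.2 h'.2
        rw [Fin.ext e4]
      refine le_trans ?_ (le_jacobiN _ ρ hρ)
      rw [Fintype.sum_prod_type]
      refine Finset.sum_le_sum fun i _ => ?_
      refine le_trans (count_ge' k _ (hka i (τ i))) ?_
      refine Finset.sum_le_sum fun h _ => ?_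
      simp only [TkA, Tka, ρ]
      by_cases hc : k ≤ (h : ℕ) + A i (τ i)
      · have e : ((h : ℕ) + A i (τ i)) % k = h + A i (τ i) - k := by
          rw [Nat.mod_eq_sub_mod hc, Nat.mod_eq_of_lt]
          have := hka i (τ i)
          have := h.2
          omega
        have := hka i (τ i)
        rw [if_pos hc, if_pos (by rw [e]; omega)]
      · simp [hc]
    exact Finset.sup_le fun τ _ => hsup τ
  · obtain ⟨u, v, huv, hJ⟩ := exists_cover hsm A
    refine le_trans ?_ hJ
    refine Finset.sup_le ?_
    rintro ⟨τ, hτ⟩ -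
    let f : Fin s × Fin k → ℕ := fun p => if k ≤ (p.2 : ℕ) + u p.1 then 1 else 0
    let g : Fin m × Fin k → ℕ := fun q => if (q.2 : ℕ) < v q.1 then 1 else 0
    have h1 : ∀ p, TkA A k p (τ p) ≤ f p + g (τ p) := by
      intro p
      have := huv p.1 (τ p).1
      have := p.2.2
      simp only [TkA, Tka, f, g]
      split_ifs <;> omega
    have h2 : ∑ p, g (τ p) ≤ ∑ q, g q := by
      refine (Finset.sum_map Finset.univ ⟨τ, hτ⟩ g).symm.le.trans ?_
      exact Finset.sum_le_sum_of_subset (Finset.subset_univ _)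
    have h3 : ∑ q, g q ≤ ∑ j, v j := by
      rw [Fintype.sum_prod_type]
      exact Finset.sum_le_sum fun j _ => count_lt k (v j)
    have h4 : ∑ p, f p ≤ ∑ i, u i := by
      rw [Fintype.sum_prod_type]
      exact Finset.sum_le_sum fun j _ => count_ge k (u j)
    calc ∑ p, TkA A k p (τ p) ≤ ∑ p, (f p + g (τ p)) := Finset.sum_le_sum fun p _ => h1 p
      _ = ∑ p, f p + ∑ p, g (τ p) := Finset.sum_add_distrib
      _ ≤ _ := by omega

end JacobiBound
end
end

section
/- Let 𝔓 ⊂ K{X_1,…,X_n} be a minimal prime differential ideal containing f_1,…,f_r, with the DAE system defined by f_1,…,f_r quasi-regular at 𝔓 and satisfying the standing rank hypothesis. Let 𝓔 = (ε_{ij}) be the r×n matrix over ℕ₀ ∪ {−∞} with ε_{ij} = ord_{X_j}(f_i) and ε_{ij} = −∞ whenever X_j does not appear in f_i. Then ord(𝔓) ≤ J(𝓔), where J(𝓔) := max over injections τ:{1,…,r}→{1,…,n} of Σ_{i=1}^r ε_{iτ(i)}. -/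
set_option synthInstance.maxHeartbeats 1000000
set_option maxHeartbeats 4000000

noncomputable section

namespace DAE

open MvPolynomial

lemma hungarian {ι κ : Type} [Fintype ι] [Fintype κ] [DecidableEq ι] [DecidableEq κ]
    (hcard : Fintype.card ι = Fintype.card κ) (P : ι → κ → Prop) (M : ι → κ → ℤ) (c : ℤ)
    (h : ∀ (α : ι → ℤ) (β : κ → ℤ), (∀ i j, P i j → M i j ≤ α i + β j) →
      c ≤ ∑ i, α i + ∑ j, β j) :
    ∃ τ : ι → κ, Function.Injective τ ∧ (∀ i, P i (τ i)) ∧ c ≤ ∑ i, M i (τ i) := by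
  classical
  let F : Set ((ι → ℤ) × (κ → ℤ)) := {x | ∀ i j, P i j → M i j ≤ x.1 i + x.2 j}
  have hF : F.Nonempty := by
    refine ⟨(fun i => ∑ j, |M i j|, 0), fun i j _ => ?_⟩
    have := Finset.single_le_sum (f := fun j => |M i j|) (fun j _ => abs_nonneg _)
      (Finset.mem_univ j)
    have h2 := le_abs_self (M i j)
    simp at this ⊢
    omega
  let g : (ι → ℤ) × (κ → ℤ) → ℕ := fun x => (∑ i, x.1 i + ∑ j, x.2 j - c).toNat
  obtain ⟨x, hx, hmin⟩ : ∃ x ∈ F, ∀ y ∈ F, g x ≤ g y := by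
    obtain ⟨x, hx, hm⟩ := (measure g).wf.has_min F hF
    exact ⟨x, hx, fun y hy => not_lt.mp (hm y hy)⟩
  obtain ⟨α, β⟩ := x
  let T : ι → Finset κ := fun i => Finset.univ.filter fun j => P i j ∧ M i j = α i + β j
  have hall : ∀ s : Finset ι, s.card ≤ (s.biUnion T).card := by
    intro s
    by_contra! hs
    let y : (ι → ℤ) × (κ → ℤ) := (fun i => α i - if i ∈ s then 1 else 0,
      fun j => β j + if j ∈ s.biUnion T then 1 else 0)
    have hy : y ∈ F := by
      intro i j hP
      have h0 : M i j ≤ α i + β j := hx i j hP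
      simp only [y]
      by_cases hi : i ∈ s
      · by_cases hj : j ∈ s.biUnion T
        · simp only [hi, hj, if_true]; omega
        · have : M i j ≠ α i + β j := fun he => hj (Finset.mem_biUnion.2 ⟨i, hi, by simp [T, hP, he]⟩)
          simp only [hi, hj, if_true, if_false]; omega
      · simp only [hi, if_false]; split_ifs <;> omega
    have h1 := hmin y hy
    have h2 := h y.1 y.2 hy
    have h3 := h α β hx
    simp only [g] at h1
    have e1 : ∑ i, y.1 i = ∑ i, α i - s.card := by
      simp [y, Finset.sum_sub_distrib]
    have e2 : ∑ j, y.2 j = ∑ j, β j + (s.biUnion T).card := by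
      simp only [y, Finset.sum_add_distrib, Finset.sum_boole, Finset.filter_univ_mem]
    rw [e1, e2] at h1 h2
    omega
  obtain ⟨τ, hτ, hT⟩ := (Finset.all_card_le_biUnion_card_iff_exists_injective T).1 hall
  have hT' : ∀ i, P i (τ i) ∧ M i (τ i) = α i + β (τ i) := fun i => by simpa [T] using hT i
  refine ⟨τ, hτ, fun i => (hT' i).1, ?_⟩
  have hb : Function.Bijective τ := (Fintype.bijective_iff_injective_and_card τ).2 ⟨hτ, hcard⟩
  rw [Finset.sum_congr rfl fun i _ => (hT' i).2, Finset.sum_add_distrib,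
    hb.sum_comp β]
  exact h α β hx

lemma exists_dual_der {K L ι : Type} [Field K] [Field L] [CharZero K] [Algebra K L] [DecidableEq ι]
    (y : ι → L) (hy : AlgebraicIndependent K y) :
    ∃ d : ι → Derivation K L L, ∀ a b, d a (y b) = if a = b then 1 else 0 := by
  classical
  have hs := (hy.to_subtype_range)
  obtain ⟨t, hst, ht⟩ := exists_isTranscendenceBasis_superset hs
  let S := MvPolynomial t K
  let : Algebra S L := (aeval (R := K) ((↑) : t → L)).toAlgebra
  have halg : ∀ p : S, algebraMap S L p = aeval ((↑) : t → L) p := fun _ => rfl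
  have : IsScalarTower K S L := IsScalarTower.of_algebraMap_eq fun x => by
    rw [halg]; simp [S]
  have : FaithfulSMul S L := (faithfulSMul_iff_algebraMap_injective S L).2 ht.1
  let F := FractionRing S
  have : Algebra.IsAlgebraic S L := by
    have := ht.isAlgebraic
    constructor
    intro x
    obtain ⟨p, hp, hpx⟩ := this.isAlgebraic x
    let e := ht.1.aevalEquiv
    refine ⟨p.map e.symm.toRingEquiv.toRingHom, ?_, ?_⟩
    · rwa [Ne, Polynomial.map_eq_zero_iff]
      exact e.symm.injective
    · rw [Polynomial.aeval_def, Polynomial.eval₂_map] 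
      rw [Polynomial.aeval_def] at hpx
      have hc : (algebraMap S L).comp e.symm.toRingEquiv.toRingHom
          = algebraMap (Algebra.adjoin K (Set.range ((↑) : t → L))) L := by
        refine RingHom.ext fun z => ?_
        obtain ⟨z, rfl⟩ := e.surjective z
        have : e.symm.toRingEquiv.toRingHom (e z) = z := e.symm_apply_apply z
        rw [RingHom.comp_apply, this, halg]
        exact (ht.1.algebraMap_aevalEquiv z).symm
      rw [hc]; exact hpx
  let : Algebra F L := FractionRing.liftAlgebra S L
  have : IsScalarTower S F L := FractionRing.isScalarTower_liftAlgebra S L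
  have : Algebra.IsAlgebraic F L :=
    (IsFractionRing.comap_isAlgebraic_iff (A := S) (K := F) (C := L)).1 inferInstance
  have : CharZero F := charZero_of_injective_algebraMap (algebraMap K F).injective
  have : Algebra.FormallyEtale F L := Algebra.FormallyEtale.of_isSeparable F L
  have : Algebra.FormallyEtale S F := Algebra.FormallyEtale.of_isLocalization (nonZeroDivisors S)
  have : Algebra.FormallyEtale S L := Algebra.FormallyEtale.comp S F L
  let E := KaehlerDifferential.tensorKaehlerEquivOfFormallyEtale K S L
  let yt : ι → t := fun a => ⟨y a, hst ⟨a, rfl⟩⟩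
  have hyt : ∀ a b, yt b = yt a ↔ a = b := fun a b => by
    simp only [yt, Subtype.mk.injEq]
    exact ⟨fun h => (hy.injective h).symm, fun h => h ▸ rfl⟩
  let d0 : ι → Derivation K S L := fun a => MvPolynomial.mkDerivation K (fun z => if z = yt a then 1 else 0)
  let l : ι → (KaehlerDifferential K L →ₗ[L] L) := fun a =>
    ((d0 a).liftKaehlerDifferential.liftBaseChange L) ∘ₗ E.symm.toLinearMap
  refine ⟨fun a => (l a).compDer (KaehlerDifferential.D K L), fun a b => ?_⟩
  have : y b = algebraMap S L (X (yt b)) := by rw [halg]; simp [yt]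
  rw [this]
  change (d0 a).liftKaehlerDifferential.liftBaseChange L
    (E.symm (KaehlerDifferential.D K L (algebraMap S L (X (yt b))))) = _
  simp only [E, KaehlerDifferential.tensorKaehlerEquivOfFormallyEtale_symm_D_algebraMap,
    LinearMap.liftBaseChange_tmul, Derivation.liftKaehlerDifferential_comp_D, one_smul]
  refine (MvPolynomial.mkDerivation_X (R := K) _ _).trans ?_
  simp only [hyt]

lemma chain_rule {K L σ : Type} [Field K] [Field L] [Algebra K L] [Algebra (MvPolynomial σ K) L]
    [IsScalarTower K (MvPolynomial σ K) L] 
    (d : Derivation K L L) (s : Finset σ) (g : MvPolynomial σ K) (hg : g ∈ supported K (s : Set σ)) :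
    d (algebraMap _ L g) = ∑ v ∈ s, algebraMap (MvPolynomial σ K) L (pderiv v g) * d (algebraMap (MvPolynomial σ K) L (X v)) := by
  let A := MvPolynomial σ K
  let d1 : Derivation K A L := d.compAlgebraMap A
  let d2 : Derivation K A L := ∑ v ∈ s,
    (LinearMap.toSpanSingleton A L (d1 (X v))).compDer (pderiv v)
  classical
  have hd2 : ∀ g, d2 g = ∑ v ∈ s, pderiv v g • d1 (X v) := by
    intro g
    have := congrFun (map_sum (Derivation.coeFnAddMonoidHom (R := K) (A := A) (M := L))
      (fun v => (LinearMap.toSpanSingleton A L (d1 (X v))).compDer (pderiv v)) s) g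
    rw [Finset.sum_apply] at this
    exact this
  have h12 : ∀ z ∈ (s : Set σ), d1 (X z) = d2 (X z) := by
    intro z hz
    rw [hd2, Finset.sum_eq_single z]
    · rw [pderiv_X_self, one_smul]
    · intro b _ hb
      rw [pderiv_X_of_ne (fun h => hb h.symm), zero_smul]
    · intro h; exact absurd hz h
  have := MvPolynomial.derivation_eqOn_supported (D₁ := d1) (D₂ := d2) h12 hg
  have e1 : d (algebraMap _ L g) = d1 g := rfl
  rw [e1, this, hd2]
  simp only [Algebra.smul_def]
  rfl

lemma supp_D {K : Type} [Field K] {n : ℕ} {δ : K → K} {D : DP K n → DP K n}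
    (hD : IsTotalDeriv K n δ D) (S T : Set (Fin n × ℕ)) (hST : S ⊆ T)
    (hS : ∀ j l, (j, l) ∈ S → (j, l + 1) ∈ T) (g : DP K n) (hg : g ∈ supported K S) :
    D g ∈ supported K T := by
  have hm := supported_mono (R := K) hST
  unfold supported at hg
  induction hg using Algebra.adjoin_induction with
  | mem x hx =>
    obtain ⟨⟨j, l⟩, hv, rfl⟩ := hx
    rw [hD.map_X]
    exact X_mem_supported.2 (hS j l hv)
  | algebraMap a =>
    rw [MvPolynomial.algebraMap_eq, hD.map_C]
    exact (supported K T).algebraMap_mem _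
  | add x y _ _ hx hy => rw [hD.map_add]; exact add_mem hx hy
  | mul x y hx' hy' hx hy =>
    rw [hD.leibniz]
    exact add_mem (mul_mem (hm hx') hy) (mul_mem (hm hy') hx)

def suppSet {K : Type} [Field K] {n : ℕ} (f : DP K n) (p : ℕ) : Set (Fin n × ℕ) :=
  {v | appearsIn f v.1 ∧ v.2 ≤ p + ordIn f v.1}

lemma supp_iter {K : Type} [Field K] {n : ℕ} {δ : K → K} {D : DP K n → DP K n}
    (hD : IsTotalDeriv K n δ D) (f : DP K n) (p : ℕ) :
    D^[p] f ∈ supported K (suppSet f p) := by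
  induction p with
  | zero =>
    rw [mem_supported]
    intro v hv
    have hv' : v ∈ f.vars.filter fun w => w.1 = v.1 := by simpa using hv
    refine ⟨⟨v, hv'⟩, ?_⟩
    have := Finset.le_sup (f := fun w : Fin n × ℕ => w.2) hv'
    unfold ordIn
    omega
  | succ p ih =>
    rw [Function.iterate_succ_apply']
    refine supp_D hD _ _ ?_ ?_ _ ih
    · rintro v ⟨h1, h2⟩; exact ⟨h1, by omega⟩
    · rintro j l ⟨h1, h2⟩; exact ⟨h1, by simp only at h2 ⊢; omega⟩

lemma pderiv_iter_eq_zero {K : Type} [Field K] {n : ℕ} {δ : K → K} {D : DP K n → DP K n}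
    (hD : IsTotalDeriv K n δ D) (f : DP K n) (p : ℕ) (v : Fin n × ℕ) (hv : v ∉ suppSet f p) :
    pderiv v (D^[p] f) = 0 := by
  apply pderiv_eq_zero_of_notMem_vars
  intro h
  exact hv (mem_supported.1 (supp_iter hD f p) h)

lemma iter_mem {K : Type} [Field K] {n : ℕ} {D : DP K n → DP K n} {𝔓 : Ideal (DP K n)}
    (h : IsDiffIdeal D 𝔓) (f : DP K n) (hf : f ∈ 𝔓) (p : ℕ) : D^[p] f ∈ 𝔓 := by
  induction p with
  | zero => exact hf
  | succ p ih => rw [Function.iterate_succ_apply']; exact h _ ih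

lemma exists_ders {K : Type} [Field K] [CharZero K] {n : ℕ} (𝔓 : Ideal (DP K n)) [𝔓.IsPrime]
    (i d : ℕ) (h : HasTrdeg K (FractionRing (AP K n i ⧸ Pc i 𝔓)) d) :
    ∃ (dd : Fin d → Derivation K (KK K n 𝔓) (KK K n 𝔓)) (u : Fin d → Fin n × ℕ),
      (∀ a, (u a).2 ≤ i) ∧ ∀ a b, dd a (toKK 𝔓 (X (u b))) = if a = b then 1 else 0 := by
  classical
  let Q := AP K n i ⧸ Pc i 𝔓
  have : IsDomain Q := Ideal.Quotient.isDomain _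
  let q : AP K n i →ₐ[K] Q := Ideal.Quotient.mkₐ K (Pc i 𝔓)
  let s : Set Q := Set.range fun v => q (X v)
  have hs : Algebra.adjoin K s = ⊤ := by
    have h1 : s = q '' (Set.range X) := by
      simp only [s, ← Set.range_comp]; rfl
    rw [h1, ← AlgHom.map_adjoin, MvPolynomial.adjoin_range_X, Algebra.map_top,
      AlgHom.range_eq_top]
    exact Ideal.Quotient.mkₐ_surjective K _
  have : Algebra.IsAlgebraic (Algebra.adjoin K s) Q := by
    constructor
    intro x
    exact isAlgebraic_algebraMap (⟨x, hs ▸ Algebra.mem_top⟩ : Algebra.adjoin K s)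
  have : FaithfulSMul K Q := inferInstance
  obtain ⟨t, hts, ht⟩ := exists_isTranscendenceBasis_subset (R := K) s
  have : Algebra.IsAlgebraic Q (FractionRing Q) :=
    (IsFractionRing.comap_isAlgebraic_iff (A := Q) (K := FractionRing Q)).2 inferInstance
  have ht2 := ht.algebraMap_comp (A := FractionRing Q)
  obtain ⟨s', hs', hcard⟩ := h
  have hc := ht2.cardinalMk_eq hs'
  have hc2 : Cardinal.mk t = (d : Cardinal) := by
    rw [hc, Cardinal.mk_coe_finset, hcard]
  have : Nonempty (Fin d ≃ t) := by
    rw [← Cardinal.mk_fin] at hc2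
    exact Cardinal.eq.1 hc2.symm
  obtain ⟨eqv⟩ := this
  have hex : ∀ a : Fin d, ∃ v : Fin n × Fin (i + 1), q (X v) = (eqv a : Q) :=
    fun a => hts (eqv a).2
  choose v hv using hex
  have hai : AlgebraicIndependent K (fun a : Fin d => q (X (v a))) := by
    have := ht.1.comp eqv eqv.injective
    convert! this using 1
    funext a
    exact hv a
  -- map to KK
  let g : AP K n i →ₐ[K] DP K n ⧸ 𝔓 := (Ideal.Quotient.mkₐ K 𝔓).comp
    (rename fun v : Fin n × Fin (i + 1) => ((v.1, (v.2 : ℕ)) : Fin n × ℕ))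
  let φ : Q →ₐ[K] DP K n ⧸ 𝔓 := Ideal.Quotient.liftₐ (Pc i 𝔓) g (fun a ha =>
    Ideal.Quotient.eq_zero_iff_mem.2 ha)
  have hφ : Function.Injective φ := by
    rw [injective_iff_map_eq_zero]
    intro x hx
    obtain ⟨x, rfl⟩ := Ideal.Quotient.mk_surjective x
    have hx2 : Ideal.Quotient.mk 𝔓 (inclA K n i x) = 0 := hx
    exact Ideal.Quotient.eq_zero_iff_mem.2 (Ideal.mem_comap.2 (Ideal.Quotient.eq_zero_iff_mem.1 hx2))
  let ψ : Q →ₐ[K] KK K n 𝔓 := (IsScalarTower.toAlgHom K (DP K n ⧸ 𝔓) (KK K n 𝔓)).comp φ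
  have hψ : Function.Injective ψ :=
    (IsFractionRing.injective (DP K n ⧸ 𝔓) (KK K n 𝔓)).comp hφ
  have hai2 := hai.map' hψ
  obtain ⟨dd, hdd⟩ := exists_dual_der _ hai2
  refine ⟨dd, fun a => ((v a).1, ((v a).2 : ℕ)), fun a => by have := (v a).2.2; simp only; omega, fun a b => ?_⟩
  rw [← hdd a b]
  congr 1
  change _ = algebraMap (DP K n ⧸ 𝔓) (KK K n 𝔓) (g (X (v b)))
  simp only [g, AlgHom.comp_apply, rename_X]
  rfl

lemma dim_bound {K : Type} [Field K] [CharZero K] {n r : ℕ} 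
    (δ : K → K)
    (D : DP K n → DP K n) (hD : IsTotalDeriv K n δ D)
    (f : Fin r → DP K n) (e : ℕ)
    (𝔓 : Ideal (DP K n)) [𝔓.IsPrime] (hdi : IsDiffIdeal D 𝔓) (hf : ∀ t, f t ∈ 𝔓)
    (hqr : IsQuasiRegularAt D f 𝔓 e) (i d : ℕ)
    (h : HasTrdeg K (FractionRing (AP K n i ⧸ Pc i 𝔓)) d)
    (a : Fin r → ℕ) (b : Fin n → ℕ)
    (hab : ∀ t j, appearsIn (f t) j → a t + ordIn (f t) j ≤ i + 1 + b j) :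
    d + ∑ t, a t ≤ n * (i + 1) + ∑ j, b j := by
  classical
  obtain ⟨dd, u, hu, hdu⟩ := exists_ders 𝔓 i d h
  let R := Σ t : Fin r, Fin (a t)
  let C := Σ j : Fin n, Fin (i + 1 + b j)
  let col : C → Fin n × ℕ := fun c => (c.1, (c.2 : ℕ))
  have hcol : Function.Injective col := by
    rintro ⟨j, l⟩ ⟨j', l'⟩ h
    simp only [col, Prod.mk.injEq] at h
    obtain ⟨rfl, h⟩ := h
    rw [Fin.ext h]
  have hcolr : ∀ v : Fin n × ℕ, v.2 < i + 1 + b v.1 → ∃ c, col c = v :=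
    fun v hv => ⟨⟨v.1, ⟨v.2, hv⟩⟩, rfl⟩
  have hsupp : ∀ ρ : R, ∀ v ∈ suppSet (f ρ.1) (ρ.2 : ℕ), v.2 < i + 1 + b v.1 := by
    rintro ⟨t, p⟩ v ⟨h1, h2⟩
    have := hab t v.1 h1
    have := p.2
    simp only at h2
    omega
  let A : Matrix R C (KK K n 𝔓) := fun ρ c => toKK 𝔓 (pderiv (col c) (D^[(ρ.2 : ℕ)] (f ρ.1)))
  -- rows independent
  have hrow : LinearIndependent (KK K n 𝔓) A.row := by
    let m := (∑ t, a t) + 1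
    have hm := hqr m (by omega)
    have hq : LinearIndependent (KK K n 𝔓) (qrJac D f 𝔓 e m).row := by
      rw [linearIndependent_iff_card_eq_finrank_span, Set.finrank, ← Matrix.rank_eq_finrank_span_row,
        hm]
      simp
    have hlt : ∀ ρ : R, (ρ.2 : ℕ) < m := fun ρ => by
      have := Finset.single_le_sum (f := a) (fun _ _ => Nat.zero_le _) (Finset.mem_univ ρ.1)
      have := ρ.2.2
      omega
    let κ : R → Fin r × Fin m := fun ρ => (ρ.1, ⟨ρ.2, hlt ρ⟩)
    have hκ : Function.Injective κ := by
      rintro ⟨j, l⟩ ⟨j', l'⟩ h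
      simp only [κ, Prod.mk.injEq, Fin.mk.injEq] at h
      obtain ⟨rfl, h⟩ := h
      rw [Fin.ext h]
    have hq2 := hq.comp κ hκ
    rw [Fintype.linearIndependent_iff] at hq2 ⊢
    intro g hg
    apply hq2 g
    funext w
    rw [Finset.sum_apply, Pi.zero_apply]
    by_cases hw : (w.2 : ℕ) < i + 1 + b w.1
    · have := congrFun hg ⟨w.1, ⟨w.2, hw⟩⟩
      rw [Finset.sum_apply] at this
      exact this
    · apply Finset.sum_eq_zero
      intro ρ _
      have : pderiv (w.1, (w.2 : ℕ)) (D^[(ρ.2 : ℕ)] (f ρ.1)) = 0 :=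
        pderiv_iter_eq_zero hD _ _ _ fun hmem => hw (hsupp ρ _ hmem)
      change g ρ • toKK 𝔓 (pderiv (w.1, (w.2 : ℕ)) (D^[(ρ.2 : ℕ)] (f ρ.1))) = 0
      rw [this, map_zero, smul_zero]
  have hrank : A.rank = ∑ t, a t := by
    rw [hrow.rank_matrix]; simp [R]
  -- kernel vectors
  let V : Fin d → (C → KK K n 𝔓) := fun k c => dd k (toKK 𝔓 (X (col c)))
  have hker : ∀ k, A.mulVecLin (V k) = 0 := by
    intro k
    funext ρ
    have hz : toKK 𝔓 (D^[(ρ.2 : ℕ)] (f ρ.1)) = 0 := by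
      have := iter_mem hdi (f ρ.1) (hf ρ.1) ρ.2
      simp only [toKK, RingHom.comp_apply, Ideal.Quotient.eq_zero_iff_mem.2 this, map_zero]
    have hg : D^[(ρ.2 : ℕ)] (f ρ.1) ∈ supported K
        ((Finset.univ.map ⟨col, hcol⟩ : Finset (Fin n × ℕ)) : Set (Fin n × ℕ)) := by
      refine supported_mono ?_ (supp_iter hD (f ρ.1) ρ.2)
      intro v hv
      obtain ⟨c, hc⟩ := hcolr v (hsupp ρ v hv)
      simp only [Finset.coe_map, Function.Embedding.coeFn_mk, Finset.coe_univ, Set.image_univ]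
      exact ⟨c, hc⟩
    have hch := chain_rule (L := KK K n 𝔓) (dd k) _ _ hg
    rw [Finset.sum_map] at hch
    have hz' : algebraMap (DP K n) (KK K n 𝔓) (D^[(ρ.2 : ℕ)] (f ρ.1)) = 0 := hz
    rw [hz', map_zero] at hch
    exact hch.symm
  have hVind : LinearIndependent (KK K n 𝔓) V := by
    rw [Fintype.linearIndependent_iff]
    intro g hg k
    obtain ⟨c, hc⟩ := hcolr (u k) (by have := hu k; omega)
    have := congrFun hg c
    rw [Finset.sum_apply] at this
    simpa [V, hc, hdu] using this
  let W : Fin d → LinearMap.ker A.mulVecLin := fun k => ⟨V k, hker k⟩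
  have hW : LinearIndependent (KK K n 𝔓) W :=
    LinearIndependent.of_comp (LinearMap.ker A.mulVecLin).subtype hVind
  have h1 := hW.fintype_card_le_finrank
  have h2 := LinearMap.finrank_range_add_finrank_ker A.mulVecLin
  have h3 : Module.finrank (KK K n 𝔓) (C → KK K n 𝔓) = n * (i + 1) + ∑ j, b j := by
    rw [Module.finrank_fintype_fun_eq_card]
    simp [C, Finset.sum_add_distrib]
  have h4 : Module.finrank (KK K n 𝔓) (LinearMap.range A.mulVecLin) = ∑ t, a t := hrank
  rw [Fintype.card_fin] at h1
  omega

/-- Jacobi's order bound: `ord(𝔓) ≤ J(𝓔)`, where `𝓔` is the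
`r×n` matrix over `ℕ₀ ∪ {−∞}` with `ε_{tj} = ord_{X_j}(f_t)` and `ε_{tj} = −∞`
whenever `X_j` does not appear in `f_t` (here `−∞ = ⊥ : WithBot ℕ`, and the order
`ord 𝔓` is encoded by the Hilbert–Kolchin constant `c`). -/
theorem order_le_jacobi
    {K : Type} [Field K] [CharZero K] {n r : ℕ} (hrn : r ≤ n)
    (δ : K → K) (hδ : IsDeriv K δ)
    (D : DP K n → DP K n) (hD : IsTotalDeriv K n δ D)
    (f : Fin r → DP K n)
    (e : ℕ) (he : e = Finset.univ.sup fun p : Fin r × Fin n => ordIn (f p.1) p.2)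
    (he1 : 1 ≤ e)
    (𝔓 : Ideal (DP K n)) [𝔓.IsPrime]
    (hmin : IsMinimalPrimeDiff D f 𝔓)
    (hqr : IsQuasiRegularAt D f 𝔓 e)
    (hsr : StandingRank D f 𝔓 e)
    (c : ℕ)
    (hord : ∃ i₀ : ℕ, ∀ i : ℕ, i₀ ≤ i →
      HasTrdeg K (FractionRing (AP K n i ⧸ Pc i 𝔓)) ((n - r) * (i + 1) + c)) :
    (c : WithBot ℕ) ≤ jacobiE (fun t j =>
      if appearsIn (f t) j then (ordIn (f t) j : WithBot ℕ) else ⊥) := by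
  classical
  obtain ⟨-, hdi, hf, -⟩ := hmin
  obtain ⟨i₀, hi₀⟩ := hord
  have hn : Nonempty (Fin n) := by
    by_contra hne
    rw [not_nonempty_iff] at hne
    have : e = 0 := by rw [he]; simp
    omega
  -- the bound for each feasible potential
  have key : ∀ (α : Fin r → ℤ) (β : Fin n → ℤ), (∀ j, 0 ≤ β j) →
      (∀ t j, appearsIn (f t) j → (ordIn (f t) j : ℤ) ≤ α t + β j) →
      (c : ℤ) ≤ ∑ t, α t + ∑ j, β j := by
    intro α β hβ hab
    let i := i₀ + ∑ t, (α t).toNat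
    have hi : ∀ t, α t ≤ i := fun t => by
      have : (α t).toNat ≤ ∑ t, (α t).toNat := Finset.single_le_sum (f := fun t => (α t).toNat)
        (fun _ _ => Nat.zero_le _) (Finset.mem_univ t)
      omega
    have hb := dim_bound δ D hD f e 𝔓 hdi hf hqr i _ (hi₀ i (by omega))
      (fun t => (i + 1 - α t).toNat) (fun j => (β j).toNat) (by
        intro t j htj
        have := hab t j htj
        have := hi t
        have := hβ j
        omega)
    have hb' : (((n - r : ℕ) * (i + 1) + c + ∑ t, (i + 1 - α t).toNat : ℕ) : ℤ) ≤
      ((n * (i + 1) + ∑ j, (β j).toNat : ℕ) : ℤ) := by exact_mod_cast hb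
    push_cast [Nat.cast_sub hrn] at hb'
    have e1 : ∑ t, max ((i : ℤ) + 1 - α t) 0 = r * (i + 1) - ∑ t, α t := by
      rw [Finset.sum_congr rfl fun t _ => max_eq_left (by have := hi t; omega)]
      simp [Finset.sum_sub_distrib]
      try ring
    have e2 : ∑ j, max (β j) 0 = ∑ j, β j := Finset.sum_congr rfl fun j _ => max_eq_left (hβ j)
    simp only [e1, e2, Int.ofNat_toNat] at hb'
    nlinarith
  let P : Fin r ⊕ Fin (n - r) → Fin n → Prop := fun x j => Sum.elim (fun t => appearsIn (f t) j) (fun _ => True) x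
  let M : Fin r ⊕ Fin (n - r) → Fin n → ℤ := fun x j => Sum.elim (fun t => (ordIn (f t) j : ℤ)) (fun _ => 0) x
  obtain ⟨τ, hτ, hP, hM⟩ := hungarian (by simp; omega) P M c (by
    intro α β hfe
    obtain ⟨j₀, hj₀⟩ := Finite.exists_min β
    have h1 := key (fun t => α (Sum.inl t) + β j₀) (fun j => β j - β j₀)
      (fun j => by have := hj₀ j; omega)
      (fun t j htj => by have := hfe (Sum.inl t) j htj; simp only [M, Sum.elim_inl] at this; omega)
    have h2 : ∑ x : Fin (n - r), (-β j₀) ≤ ∑ x, α (Sum.inr x) :=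
      Finset.sum_le_sum fun x _ => by
        have := hfe (Sum.inr x) j₀ trivial
        simp only [M, Sum.elim_inr] at this; omega
    rw [Fintype.sum_sum_type]
    simp only [Finset.sum_add_distrib, Finset.sum_sub_distrib, Finset.sum_const, Finset.card_univ,
      Fintype.card_fin, nsmul_eq_mul, Nat.cast_sub hrn] at h1 h2
    nlinarith)
  have hP' : ∀ t, appearsIn (f t) (τ (Sum.inl t)) := fun t => hP (Sum.inl t)
  have hc : c ≤ ∑ t, ordIn (f t) (τ (Sum.inl t)) := by
    rw [Fintype.sum_sum_type] at hM
    simp only [M, Sum.elim_inl, Sum.elim_inr, Finset.sum_const_zero, add_zero] at hM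
    exact_mod_cast hM
  unfold jacobiE
  refine le_trans ?_ (Finset.le_sup (Finset.mem_univ
    (⟨fun t => τ (Sum.inl t), hτ.comp Sum.inl_injective⟩ : {τ : Fin r → Fin n // Function.Injective τ})))
  simp only [hP', if_true]
  exact_mod_cast hc

end DAE
end
end
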